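/- Let 1 < p < ∞, 0 < q ≤ ∞, and k ∈ ℕ. Let f ∈ L_1(𝕋) have Fourier series f(x) ~ ∑_{n=1}^∞ (a_n cos nx + b_n sin nx), where {a_n} and {b_n} are nonnegative general monotone sequences. Then for every j ∈ ℕ_0, ω_k(f, 2^{−j})_{p,q} ≍ 2^{−jk} (∑_{ν=0}^{j} 2^{ν(k + 1/p')q} (a_{2^ν}^q + b_{2^ν}^q))^{1/q} + (∑_{ν=j}^{∞} 2^{νq/p'} (a_{2^ν}^q + b_{2^ν}^q))^{1/q} (with the usual modification if q = ∞), with equivalence constants independent of f and j. -/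

import Mathlib

open MeasureTheory ENNReal Set Filter Real

noncomputable section

/-- Non-increasing rearrangement of an `ℝ≥0∞`-valued function w.r.t. a measure. -/
def rearr {α : Type*} [MeasurableSpace α] (μ : Measure α) (g : α → ℝ≥0∞) (t : ℝ) : ℝ≥0∞ :=
  sInf {l : ℝ≥0∞ | μ {x | l < g x} ≤ ENNReal.ofReal t}

/-- Non-increasing rearrangement of a real-valued function. -/
def rearrR {α : Type*} [MeasurableSpace α] (μ : Measure α) (f : α → ℝ) (t : ℝ) : ℝ≥0∞ :=
  rearr μ (fun x => ENNReal.ofReal |f x|) t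

/-- The maximal function `f^{**}(t) = t⁻¹ ∫_0^t f^*`. -/
def rearrStar {α : Type*} [MeasurableSpace α] (μ : Measure α) (f : α → ℝ) (t : ℝ) : ℝ≥0∞ :=
  (ENNReal.ofReal t)⁻¹ * ∫⁻ s in Set.Ioo (0:ℝ) t, rearrR μ f s

/-- `(∫_I g(t)^q dt/t)^{1/q}`, with the usual sup modification when `q = ∞`. -/
def qnorm (q : ℝ≥0∞) (I : Set ℝ) (g : ℝ → ℝ≥0∞) : ℝ≥0∞ :=
  if q = ∞ then ⨆ t ∈ I, g t
  else (∫⁻ t in I, g t ^ q.toReal / ENNReal.ofReal t) ^ (1 / q.toReal)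

/-- the measure of the torus `(0, 2π)` -/
def torusMeasure : Measure ℝ := volume.restrict (Set.Ioo 0 (2 * π))

/-- intervals -/
def IsInterval (Q : Set ℝ) : Prop := ∃ a l : ℝ, 0 < l ∧ Q = Set.Icc a (a + l)

/-- the sharp maximal function on the line -/
def sharpT (f : ℝ → ℝ) (x : ℝ) : ℝ≥0∞ :=
  ⨆ Q ∈ {Q : Set ℝ | IsInterval Q ∧ x ∈ Q},
    ENNReal.ofReal (⨍ y in Q, |f y - ⨍ z in Q, f z|)

def diffOpT (h : ℝ) (f : ℝ → ℝ) : ℝ → ℝ := fun x => f (x + h) - f x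

def iterDiffT (k : ℕ) (h : ℝ) (f : ℝ → ℝ) : ℝ → ℝ := (diffOpT h)^[k] f

def lorentzT (f : ℝ → ℝ) (p : ℝ) (q : ℝ≥0∞) : ℝ≥0∞ :=
  qnorm q (Set.Ioo 0 1) (fun t => ENNReal.ofReal (t ^ (1 / p)) * rearrR torusMeasure f t)

/-- modulus of smoothness on the torus -/
def modulusT (k : ℕ) (f : ℝ → ℝ) (p : ℝ) (q : ℝ≥0∞) (t : ℝ) : ℝ≥0∞ :=
  ⨆ h ∈ {h : ℝ | |h| ≤ t}, lorentzT (iterDiffT k h f) p q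

/-- first-order modulus in `L_1(𝕋)` -/
def modulusL1T (k : ℕ) (f : ℝ → ℝ) (t : ℝ) : ℝ≥0∞ :=
  ⨆ h ∈ {h : ℝ | |h| ≤ t}, ∫⁻ x in Set.Ioo 0 (2 * π), ENNReal.ofReal |iterDiffT k h f x|

/-- a slowly varying function -/
def SlowlyVarying (b : ℝ → ℝ) : Prop :=
  ∀ lam : ℝ, 0 < lam → Tendsto (fun t => b (lam * t) / b t) atTop (nhds 1)



/-- A general monotone sequence with constant `C`. -/
def GMSeq (C : ℝ) (a : ℕ → ℝ) : Prop :=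
  ∀ n : ℕ, 1 ≤ n → ∑ ν ∈ Finset.Ico n (2 * n), |a ν - a (ν + 1)| ≤ C * |a n|

/-- `(∑_{ν=0}^{j} (2^{ν e})^q (a_{2^ν}^q + b_{2^ν}^q))^{1/q}`, with the usual
modification if `q = ∞`. -/
def dyadS1 (q : ℝ≥0∞) (e : ℝ) (a b : ℕ → ℝ) (j : ℕ) : ℝ≥0∞ :=
  if q = ∞ then
    ⨆ ν ∈ {ν : ℕ | ν ≤ j},
      ENNReal.ofReal ((2 : ℝ) ^ ((ν : ℝ) * e) * max (a (2 ^ ν)) (b (2 ^ ν)))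
  else (∑ ν ∈ Finset.range (j + 1),
      ENNReal.ofReal ((2 : ℝ) ^ ((ν : ℝ) * e * q.toReal) *
        (a (2 ^ ν) ^ q.toReal + b (2 ^ ν) ^ q.toReal))) ^ (1 / q.toReal)

/-- `(∑_{ν=j}^{∞} (2^{ν e})^q (a_{2^ν}^q + b_{2^ν}^q))^{1/q}`, with the usual
modification if `q = ∞`. -/
def dyadS2 (q : ℝ≥0∞) (e : ℝ) (a b : ℕ → ℝ) (j : ℕ) : ℝ≥0∞ :=
  if q = ∞ then
    ⨆ ν ∈ {ν : ℕ | j ≤ ν},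
      ENNReal.ofReal ((2 : ℝ) ^ ((ν : ℝ) * e) * max (a (2 ^ ν)) (b (2 ^ ν)))
  else (∑' ν : ℕ,
      if j ≤ ν then
        ENNReal.ofReal ((2 : ℝ) ^ ((ν : ℝ) * e * q.toReal) *
          (a (2 ^ ν) ^ q.toReal + b (2 ^ ν) ^ q.toReal))
      else 0) ^ (1 / q.toReal)




/-- The (quasi-)norm of `ℓ_q(ℕ)`. -/
def ellq (q : ℝ≥0∞) (x : ℕ → ℝ≥0∞) : ℝ≥0∞ :=
  if q = ∞ then ⨆ i, x i else (∑' i, x i ^ q.toReal) ^ (1 / q.toReal)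

/-- geometrically decaying kernel -/
def gker (θ : ℝ≥0∞) (m n : ℕ) : ℝ≥0∞ := θ ^ ((m : ℤ) - n).natAbs

lemma gker_sum_le (θ : ℝ≥0∞) (hθ : θ ≤ 1) (m : ℕ) :
    ∑' n, gker θ m n ≤ 2 * (1 - θ)⁻¹ := by
  have h1 : ∑' n : ℕ, gker θ m n ≤ ∑' z : ℤ, θ ^ z.natAbs := by
    have hinj : Function.Injective (fun n : ℕ => (m : ℤ) - n) := by
      intro a b h
      simp only at h
      omega
    exact ENNReal.tsum_comp_le_tsum_of_injective hinj (fun z : ℤ => θ ^ z.natAbs)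
  refine h1.trans ?_
  have h2 : ∑' z : ℤ, θ ^ z.natAbs ≤ ∑' s : ℕ ⊕ ℕ, θ ^ (Sum.elim id id s) := by
    rw [← Equiv.intEquivNatSumNat.tsum_eq (fun s : ℕ ⊕ ℕ => θ ^ (Sum.elim id id s))]
    refine ENNReal.tsum_le_tsum fun z => ?_
    cases z with
    | ofNat n => exact le_refl _
    | negSucc n =>
      simp only [Equiv.intEquivNatSumNat, Int.natAbs_negSucc]
      exact pow_le_pow_right_of_le_one' hθ (Nat.le_succ n)
  refine h2.trans ?_
  rw [Summable.tsum_sum ENNReal.summable ENNReal.summable]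
  simp [ENNReal.tsum_geometric, two_mul]

lemma gker_comm (θ : ℝ≥0∞) (m n : ℕ) : gker θ m n = gker θ n m := by
  unfold gker; congr 1; omega

lemma gker_rpow (θ : ℝ≥0∞) (s : ℝ) (m n : ℕ) : gker θ m n ^ s = gker (θ ^ s) m n := by
  unfold gker
  rw [← ENNReal.rpow_natCast, ← ENNReal.rpow_natCast, ← ENNReal.rpow_mul, ← ENNReal.rpow_mul,
    mul_comm]

lemma ellq_mono {q : ℝ≥0∞} {x y : ℕ → ℝ≥0∞} (h : ∀ i, x i ≤ y i) : ellq q x ≤ ellq q y := by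
  unfold ellq
  split_ifs
  · exact iSup_mono h
  · gcongr with i
    exact h i

lemma ellq_const_mul {q : ℝ≥0∞} (hq : 0 < q) (c : ℝ≥0∞) (x : ℕ → ℝ≥0∞) :
    ellq q (fun i => c * x i) = c * ellq q x := by
  unfold ellq
  split_ifs with h
  · rw [ENNReal.mul_iSup]
  · have hr : 0 < q.toReal := ENNReal.toReal_pos hq.ne' h
    simp_rw [ENNReal.mul_rpow_of_nonneg _ _ hr.le]
    rw [ENNReal.tsum_mul_left, ENNReal.mul_rpow_of_nonneg _ _ (by positivity), ← ENNReal.rpow_mul,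
      mul_one_div_cancel hr.ne', ENNReal.rpow_one]

lemma ellq_le_term {q : ℝ≥0∞} (hq : 0 < q) (x : ℕ → ℝ≥0∞) (i : ℕ) : x i ≤ ellq q x := by
  unfold ellq
  split_ifs with h
  · exact le_iSup x i
  · have hr : 0 < q.toReal := ENNReal.toReal_pos hq.ne' h
    calc x i = (x i ^ q.toReal) ^ (1 / q.toReal) := by
          rw [← ENNReal.rpow_mul, mul_one_div_cancel hr.ne', ENNReal.rpow_one]
      _ ≤ _ := by
          gcongr
          exact ENNReal.le_tsum i

lemma ellq_young {q : ℝ≥0∞} (hq : 0 < q) (θ : ℝ≥0∞) (hθ : θ < 1) :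
    ∃ C : ℝ≥0∞, C ≠ ∞ ∧ ∀ x y : ℕ → ℝ≥0∞, (∀ m, y m ≤ ∑' n, gker θ m n * x n) →
      ellq q y ≤ C * ellq q x := by
  have hfin : ∀ s : ℝ, 0 < s → 2 * (1 - θ ^ s)⁻¹ ≠ ∞ := by
    intro s hs
    have : θ ^ s < 1 := ENNReal.rpow_lt_one hθ hs
    have h2 : 1 - θ ^ s ≠ 0 := (tsub_pos_of_lt this).ne'
    exact ENNReal.mul_ne_top (by simp) (ENNReal.inv_ne_top.2 h2)
  by_cases h : q = ∞
  · refine ⟨2 * (1 - θ)⁻¹, by simpa using hfin 1 one_pos, fun x y hxy => ?_⟩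
    simp only [ellq, h, if_true]
    refine iSup_le fun m => (hxy m).trans ?_
    calc ∑' n, gker θ m n * x n ≤ ∑' n, gker θ m n * ⨆ i, x i := by
          gcongr with n; exact le_iSup x n
      _ = (∑' n, gker θ m n) * ⨆ i, x i := ENNReal.tsum_mul_right
      _ ≤ _ := by gcongr; exact gker_sum_le θ hθ.le m
  · have hr : 0 < q.toReal := ENNReal.toReal_pos hq.ne' h
    set r := q.toReal with hrdef
    set S := 2 * (1 - θ ^ (1/2 : ℝ))⁻¹ with hS
    set S' := 2 * (1 - θ ^ (r/2 : ℝ))⁻¹ with hS'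
    refine ⟨S * S' ^ (1 / r), ENNReal.mul_ne_top (hfin _ (by norm_num))
      (ENNReal.rpow_ne_top_of_nonneg (by positivity) (hfin _ (by positivity))), fun x y hxy => ?_⟩
    simp only [ellq, h, if_false]
    have key : ∀ m, y m ^ r ≤ S ^ r * ∑' n, gker (θ ^ (r/2)) m n * x n ^ r := by
      intro m
      have h1 : y m ≤ S * ⨆ n, gker (θ ^ (1/2 : ℝ)) m n * x n := by
        refine (hxy m).trans ?_
        calc ∑' n, gker θ m n * x n
            ≤ ∑' n, gker (θ ^ (1/2 : ℝ)) m n * ⨆ n, gker (θ ^ (1/2 : ℝ)) m n * x n := by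
              refine ENNReal.tsum_le_tsum fun n => ?_
              have : gker θ m n = gker (θ ^ (1/2 : ℝ)) m n * gker (θ ^ (1/2 : ℝ)) m n := by
                rw [← gker_rpow, ← ENNReal.rpow_add_of_nonneg _ _ (by norm_num) (by norm_num)]
                norm_num
              rw [this, mul_assoc]
              gcongr
              exact le_iSup (fun n => gker (θ ^ (1/2 : ℝ)) m n * x n) n
          _ = (∑' n, gker (θ ^ (1/2 : ℝ)) m n) * _ := ENNReal.tsum_mul_right
          _ ≤ _ := by gcongr; exact gker_sum_le _ (ENNReal.rpow_le_one hθ.le (by norm_num)) m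
      calc y m ^ r ≤ (S * ⨆ n, gker (θ ^ (1/2 : ℝ)) m n * x n) ^ r := by gcongr
        _ = S ^ r * (⨆ n, gker (θ ^ (1/2 : ℝ)) m n * x n) ^ r :=
            ENNReal.mul_rpow_of_nonneg _ _ hr.le
        _ ≤ _ := by
          gcongr
          rw [← ENNReal.orderIsoRpow_apply r hr, OrderIso.map_iSup]
          refine iSup_le fun n => ?_
          rw [ENNReal.orderIsoRpow_apply, ENNReal.mul_rpow_of_nonneg _ _ hr.le, gker_rpow,
            ← ENNReal.rpow_mul]
          have : (1/2 : ℝ) * r = r / 2 := by ring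
          rw [this]
          exact ENNReal.le_tsum n
    calc (∑' m, y m ^ r) ^ (1 / r) ≤ (S ^ r * (S' * ∑' n, x n ^ r)) ^ (1 / r) := by
          gcongr
          calc ∑' m, y m ^ r ≤ ∑' m, S ^ r * ∑' n, gker (θ ^ (r/2)) m n * x n ^ r := by
                gcongr with m; exact key m
            _ = S ^ r * ∑' n, ∑' m, gker (θ ^ (r/2)) n m * x n ^ r := by
                rw [ENNReal.tsum_mul_left, ENNReal.tsum_comm]
                simp_rw [gker_comm]
            _ ≤ _ := by
                gcongr
                rw [← ENNReal.tsum_mul_left]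
                gcongr with n
                rw [ENNReal.tsum_mul_right]
                gcongr
                exact gker_sum_le _ (ENNReal.rpow_le_one hθ.le (by positivity)) n
      _ = _ := by
          rw [ENNReal.mul_rpow_of_nonneg (S ^ r) _ (by positivity),
            ENNReal.mul_rpow_of_nonneg S' _ (by positivity), ← ENNReal.rpow_mul,
            mul_one_div_cancel hr.ne', ENNReal.rpow_one, ← mul_assoc]



/-- damping factor `min(1, 2^{ν-j})^k` -/
def tauF (k j ν : ℕ) : ℝ := (min 1 ((2:ℝ) ^ ν / 2 ^ j)) ^ k

lemma tauF_nonneg (k j ν : ℕ) : 0 ≤ tauF k j ν := by unfold tauF; positivity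

lemma tauF_low {k j ν : ℕ} (h : ν ≤ j) : tauF k j ν = ((2:ℝ) ^ ν / 2 ^ j) ^ k := by
  unfold tauF
  rw [min_eq_right]
  rw [div_le_one (by positivity)]
  exact pow_le_pow_right₀ (by norm_num) h

lemma tauF_high {k j ν : ℕ} (h : j ≤ ν) : tauF k j ν = 1 := by
  unfold tauF
  rw [min_eq_left, one_pow]
  rw [one_le_div (by positivity)]
  exact pow_le_pow_right₀ (by norm_num) h

/-- the weighted dyadic sequence -/
def yseq (k j : ℕ) (e : ℝ) (a b : ℕ → ℝ) (ν : ℕ) : ℝ≥0∞ :=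
  ENNReal.ofReal ((2:ℝ) ^ ((ν:ℝ) * e) * (a (2 ^ ν) + b (2 ^ ν)) * tauF k j ν)

lemma low_factor (k j ν : ℕ) (e : ℝ) (h : ν ≤ j) :
    (2:ℝ) ^ (-(j:ℝ) * k) * (2:ℝ) ^ ((ν:ℝ) * (k + e)) = (2:ℝ) ^ ((ν:ℝ) * e) * tauF k j ν := by
  rw [tauF_low h, div_pow, ← pow_mul, ← pow_mul, ← Real.rpow_natCast, ← Real.rpow_natCast,
    ← Real.rpow_sub two_pos, ← Real.rpow_add two_pos, ← Real.rpow_add two_pos]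
  congr 1
  push_cast
  ring

lemma sum_rpow_le {a b r : ℝ} (ha : 0 ≤ a) (hb : 0 ≤ b) (hr : 0 < r) :
    a ^ r + b ^ r ≤ 2 * (a + b) ^ r := by
  have h1 : a ^ r ≤ (a + b) ^ r := Real.rpow_le_rpow ha (by linarith) hr.le
  have h2 : b ^ r ≤ (a + b) ^ r := Real.rpow_le_rpow hb (by linarith) hr.le
  linarith

lemma le_sum_rpow {a b r : ℝ} (ha : 0 ≤ a) (hb : 0 ≤ b) (hr : 0 < r) :
    (a + b) ^ r ≤ 2 ^ r * (a ^ r + b ^ r) := by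
  have ha' : 0 ≤ a ^ r := Real.rpow_nonneg ha r
  have hb' : 0 ≤ b ^ r := Real.rpow_nonneg hb r
  have h2 : (0:ℝ) ≤ 2 ^ r := by positivity
  rcases le_total a b with h | h
  · calc (a + b) ^ r ≤ (2 * b) ^ r := Real.rpow_le_rpow (by positivity) (by linarith) hr.le
      _ = 2 ^ r * b ^ r := Real.mul_rpow (by norm_num) hb
      _ ≤ _ := by gcongr; linarith
  · calc (a + b) ^ r ≤ (2 * a) ^ r := Real.rpow_le_rpow (by positivity) (by linarith) hr.le
      _ = 2 ^ r * a ^ r := Real.mul_rpow (by norm_num) ha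
      _ ≤ _ := by gcongr; linarith

/-- the right-hand side of the theorem -/
def rhsT (q : ℝ≥0∞) (k j : ℕ) (e : ℝ) (a b : ℕ → ℝ) : ℝ≥0∞ :=
  ENNReal.ofReal ((2 : ℝ) ^ (-(j : ℝ) * k)) * dyadS1 q ((k : ℝ) + e) a b j + dyadS2 q e a b j

lemma yseq_rpow (k j : ℕ) (e : ℝ) (a b : ℕ → ℝ) (ha : ∀ n, 0 ≤ a n) (hb : ∀ n, 0 ≤ b n)
    (r : ℝ) (hr : 0 < r) (ν : ℕ) : yseq k j e a b ν ^ r =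
      ENNReal.ofReal (((2:ℝ) ^ ((ν:ℝ) * e) * tauF k j ν) ^ r * (a (2 ^ ν) + b (2 ^ ν)) ^ r) := by
  have h0 := tauF_nonneg k j ν
  have h1 := ha (2 ^ ν)
  have h2 := hb (2 ^ ν)
  unfold yseq
  rw [ENNReal.ofReal_rpow_of_nonneg (by positivity) hr.le, ← Real.mul_rpow (by positivity)
    (by positivity)]
  congr 2; ring

lemma low_pow {q : ℝ≥0∞} (hr : 0 < q.toReal) (k j : ℕ) (e : ℝ) (a b : ℕ → ℝ)
    (h : q ≠ ∞) (ha : ∀ n, 0 ≤ a n) (hb : ∀ n, 0 ≤ b n) :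
    ENNReal.ofReal ((2 : ℝ) ^ (-(j : ℝ) * k)) * dyadS1 q ((k : ℝ) + e) a b j =
    (∑ ν ∈ Finset.range (j + 1), ENNReal.ofReal (((2:ℝ) ^ ((ν:ℝ) * e) * tauF k j ν) ^ q.toReal *
        (a (2 ^ ν) ^ q.toReal + b (2 ^ ν) ^ q.toReal))) ^ (1 / q.toReal) := by
  simp only [dyadS1, h, if_false]
  set r := q.toReal
  have e1 : ENNReal.ofReal ((2 : ℝ) ^ (-(j : ℝ) * k)) =
      (ENNReal.ofReal ((2 : ℝ) ^ (-(j : ℝ) * k)) ^ r) ^ (1 / r) := by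
    rw [← ENNReal.rpow_mul, mul_one_div_cancel hr.ne', ENNReal.rpow_one]
  rw [e1, ← ENNReal.mul_rpow_of_nonneg _ _ (by positivity), Finset.mul_sum]
  congr 1
  refine Finset.sum_congr rfl fun ν hν => ?_
  rw [ENNReal.ofReal_rpow_of_nonneg (by positivity) hr.le, ← ENNReal.ofReal_mul (by positivity),
    ← low_factor k j ν e (by simpa [Nat.lt_succ_iff] using hν),
    Real.mul_rpow (by positivity) (by positivity), ← Real.rpow_mul (by norm_num) ((ν:ℝ) * _)]
  congr 1; ring

lemma rhsT_le {q : ℝ≥0∞} (hq : 0 < q) : ∃ C : ℝ≥0∞, C ≠ ∞ ∧ ∀ (k j : ℕ) (e : ℝ) (a b : ℕ → ℝ),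
    (∀ n, 0 ≤ a n) → (∀ n, 0 ≤ b n) → rhsT q k j e a b ≤ C * ellq q (yseq k j e a b) := by
  by_cases h : q = ∞
  · refine ⟨2, by simp, fun k j e a b ha hb => ?_⟩
    rw [two_mul]
    refine add_le_add ?_ ?_
    · simp only [dyadS1, ellq, h, if_true]
      rw [ENNReal.mul_iSup]
      refine iSup_le fun ν => ?_
      rw [ENNReal.mul_iSup]
      refine iSup_le fun hν => ?_
      refine le_trans ?_ (le_iSup _ ν)
      have hν' : ν ≤ j := hν
      rw [← ENNReal.ofReal_mul (by positivity), ← mul_assoc, low_factor k j ν e hν']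
      unfold yseq
      apply ENNReal.ofReal_le_ofReal
      rw [mul_right_comm]
      have h0 := tauF_nonneg k j ν
      gcongr
      exact max_le (by linarith [hb (2 ^ ν)]) (by linarith [ha (2 ^ ν)])
    · simp only [dyadS2, ellq, h, if_true]
      refine iSup_le fun ν => iSup_le fun hν => ?_
      refine le_trans ?_ (le_iSup _ ν)
      have hν' : j ≤ ν := hν
      unfold yseq
      rw [tauF_high hν', mul_one]
      gcongr
      exact max_le (by linarith [hb (2 ^ ν)]) (by linarith [ha (2 ^ ν)])
  · have hr : 0 < q.toReal := ENNReal.toReal_pos hq.ne' h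
    refine ⟨2 ^ (1 / q.toReal) + 2 ^ (1 / q.toReal), ?_, fun k j e a b ha hb => ?_⟩
    · have : (2:ℝ≥0∞) ^ (1 / q.toReal) ≠ ∞ :=
        ENNReal.rpow_ne_top_of_nonneg (by positivity) (by simp)
      exact ENNReal.add_ne_top.2 ⟨this, this⟩
    have hterm : ∀ ν : ℕ, ENNReal.ofReal (((2:ℝ) ^ ((ν:ℝ) * e) * tauF k j ν) ^ q.toReal *
        (a (2 ^ ν) ^ q.toReal + b (2 ^ ν) ^ q.toReal)) ≤ 2 * yseq k j e a b ν ^ q.toReal := by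
      intro ν
      rw [yseq_rpow k j e a b ha hb _ hr]
      have : (2 : ℝ≥0∞) = ENNReal.ofReal 2 := by simp
      rw [this, ← ENNReal.ofReal_mul (by norm_num)]
      apply ENNReal.ofReal_le_ofReal
      have h0 := tauF_nonneg k j ν
      calc _ ≤ ((2:ℝ) ^ ((ν:ℝ) * e) * tauF k j ν) ^ q.toReal *
            (2 * (a (2 ^ ν) + b (2 ^ ν)) ^ q.toReal) := by
              gcongr; exact sum_rpow_le (ha _) (hb _) hr
        _ = _ := by ring
    have hfin : ∀ T : ℝ≥0∞, T ≤ 2 * ∑' ν, yseq k j e a b ν ^ q.toReal →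
        T ^ (1 / q.toReal) ≤ 2 ^ (1 / q.toReal) * ellq q (yseq k j e a b) := by
      intro T hT
      simp only [ellq, h, if_false]
      rw [← ENNReal.mul_rpow_of_nonneg _ _ (by positivity)]
      gcongr
    rw [add_mul]
    refine add_le_add ?_ ?_
    · rw [low_pow hr k j e a b h ha hb]
      apply hfin
      rw [← ENNReal.tsum_mul_left]
      exact (Finset.sum_le_sum fun ν _ => hterm ν).trans (ENNReal.sum_le_tsum _)
    · simp only [dyadS2, h, if_false]
      apply hfin
      rw [← ENNReal.tsum_mul_left]
      refine ENNReal.tsum_le_tsum fun ν => ?_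
      split_ifs with hν
      · refine le_trans (le_of_eq ?_) (hterm ν)
        rw [tauF_high hν, mul_one, ← Real.rpow_mul (by norm_num)]
      · exact zero_le

lemma le_rhsT {q : ℝ≥0∞} (hq : 0 < q) : ∃ C : ℝ≥0∞, C ≠ ∞ ∧ ∀ (k j : ℕ) (e : ℝ) (a b : ℕ → ℝ),
    (∀ n, 0 ≤ a n) → (∀ n, 0 ≤ b n) → ellq q (yseq k j e a b) ≤ C * rhsT q k j e a b := by
  by_cases h : q = ∞
  · refine ⟨2, by simp, fun k j e a b ha hb => ?_⟩
    conv_lhs => simp only [ellq, h, if_true]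
    refine iSup_le fun ν => ?_
    have hy : yseq k j e a b ν ≤ 2 * ENNReal.ofReal (((2:ℝ) ^ ((ν:ℝ) * e) * tauF k j ν) *
        max (a (2 ^ ν)) (b (2 ^ ν))) := by
      have : (2 : ℝ≥0∞) = ENNReal.ofReal 2 := by simp
      rw [this, ← ENNReal.ofReal_mul (by norm_num)]
      apply ENNReal.ofReal_le_ofReal
      have h0 := tauF_nonneg k j ν
      have h3 : a (2 ^ ν) + b (2 ^ ν) ≤ 2 * max (a (2 ^ ν)) (b (2 ^ ν)) := by
        linarith [le_max_left (a (2 ^ ν)) (b (2 ^ ν)), le_max_right (a (2 ^ ν)) (b (2 ^ ν))]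
      calc _ = ((2:ℝ) ^ ((ν:ℝ) * e) * tauF k j ν) * (a (2 ^ ν) + b (2 ^ ν)) := by ring
        _ ≤ ((2:ℝ) ^ ((ν:ℝ) * e) * tauF k j ν) * (2 * max (a (2 ^ ν)) (b (2 ^ ν))) := by
            gcongr
        _ = _ := by ring
    refine hy.trans ?_
    gcongr
    unfold rhsT
    rcases le_total ν j with hν | hν
    · refine le_trans ?_ le_self_add
      simp only [dyadS1, h, if_true]
      rw [← low_factor k j ν e hν, mul_assoc, ENNReal.ofReal_mul (by positivity)]
      gcongr
      exact le_iSup₂ (f := fun (ν : ℕ) (_ : ν ∈ {ν : ℕ | ν ≤ j}) => ENNReal.ofReal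
        ((2 : ℝ) ^ ((ν : ℝ) * (k + e)) * max (a (2 ^ ν)) (b (2 ^ ν)))) ν hν
    · refine le_trans ?_ le_add_self
      simp only [dyadS2, h, if_true]
      rw [tauF_high hν, mul_one]
      exact le_iSup₂ (f := fun (ν : ℕ) (_ : ν ∈ {ν : ℕ | j ≤ ν}) => ENNReal.ofReal
        ((2 : ℝ) ^ ((ν : ℝ) * e) * max (a (2 ^ ν)) (b (2 ^ ν)))) ν hν
  · have hr : 0 < q.toReal := ENNReal.toReal_pos hq.ne' h
    set r := q.toReal with hrd
    refine ⟨(2 ^ r) ^ (1 / r) * 2 ^ (1 / r), ?_, fun k j e a b ha hb => ?_⟩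
    · exact ENNReal.mul_ne_top (ENNReal.rpow_ne_top_of_nonneg (by positivity)
        (ENNReal.rpow_ne_top_of_nonneg (by positivity) (by simp)))
        (ENNReal.rpow_ne_top_of_nonneg (by positivity) (by simp))
    set S1 := ∑ ν ∈ Finset.range (j + 1), ENNReal.ofReal (((2:ℝ) ^ ((ν:ℝ) * e) * tauF k j ν) ^ r *
        (a (2 ^ ν) ^ r + b (2 ^ ν) ^ r)) with hS1
    set S2 := ∑' ν : ℕ, if j ≤ ν then ENNReal.ofReal ((2 : ℝ) ^ ((ν : ℝ) * e * r) *
          (a (2 ^ ν) ^ r + b (2 ^ ν) ^ r)) else 0 with hS2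
    have hR : rhsT q k j e a b = S1 ^ (1 / r) + S2 ^ (1 / r) := by
      unfold rhsT
      rw [low_pow hr k j e a b h ha hb]
      simp only [dyadS2, h, if_false]
      rfl
    have hterm : ∀ ν : ℕ, yseq k j e a b ν ^ r ≤ 2 ^ r * ENNReal.ofReal
        (((2:ℝ) ^ ((ν:ℝ) * e) * tauF k j ν) ^ r * (a (2 ^ ν) ^ r + b (2 ^ ν) ^ r)) := by
      intro ν
      rw [yseq_rpow k j e a b ha hb _ hr]
      have : (2 : ℝ≥0∞) ^ r = ENNReal.ofReal (2 ^ r) := by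
        rw [← ENNReal.ofReal_rpow_of_nonneg (by norm_num) hr.le]; simp
      rw [this, ← ENNReal.ofReal_mul (by positivity)]
      apply ENNReal.ofReal_le_ofReal
      have h0 := tauF_nonneg k j ν
      calc _ ≤ ((2:ℝ) ^ ((ν:ℝ) * e) * tauF k j ν) ^ r *
            (2 ^ r * (a (2 ^ ν) ^ r + b (2 ^ ν) ^ r)) := by
              gcongr; exact le_sum_rpow (ha _) (hb _) hr
        _ = _ := by ring
    have hsum : ∑' ν, yseq k j e a b ν ^ r ≤ 2 ^ r * (S1 + S2) := by
      have e1 : S1 = ∑' ν : ℕ, if ν ∈ Finset.range (j+1) then ENNReal.ofReal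
          (((2:ℝ) ^ ((ν:ℝ) * e) * tauF k j ν) ^ r * (a (2 ^ ν) ^ r + b (2 ^ ν) ^ r)) else 0 := by
        rw [tsum_eq_sum (s := Finset.range (j+1)) (by intro ν hν; simp only [hν, if_false])]
        refine Finset.sum_congr rfl fun ν hν => ?_
        simp only [hν, if_true]
      rw [e1, hS2, ← ENNReal.tsum_add, ← ENNReal.tsum_mul_left]
      refine ENNReal.tsum_le_tsum fun ν => (hterm ν).trans ?_
      gcongr
      by_cases hν : ν ∈ Finset.range (j+1)
      · simp only [hν, if_true]; exact le_self_add
      · have hν2 : j ≤ ν := by simp at hν; omega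
        simp only [hν2, if_true]
        rw [tauF_high hν2, mul_one, ← Real.rpow_mul (by norm_num)]
        exact le_add_self
    simp only [ellq, h, if_false]
    rw [hR]
    calc (∑' ν, yseq k j e a b ν ^ r) ^ (1 / r) ≤ (2 ^ r * (S1 + S2)) ^ (1 / r) := by gcongr
      _ = (2 ^ r) ^ (1 / r) * (S1 + S2) ^ (1 / r) := ENNReal.mul_rpow_of_nonneg _ _ (by positivity)
      _ ≤ (2 ^ r) ^ (1 / r) * (2 ^ (1 / r) * (S1 ^ (1 / r) + S2 ^ (1 / r))) := by
          gcongr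
          rcases le_total S1 S2 with hh | hh
          · calc (S1 + S2) ^ (1 / r) ≤ (2 * S2) ^ (1 / r) := by rw [two_mul]; gcongr
              _ = 2 ^ (1 / r) * S2 ^ (1 / r) := ENNReal.mul_rpow_of_nonneg _ _ (by positivity)
              _ ≤ _ := by gcongr; exact le_add_self
          · calc (S1 + S2) ^ (1 / r) ≤ (2 * S1) ^ (1 / r) := by rw [two_mul]; gcongr
              _ = 2 ^ (1 / r) * S1 ^ (1 / r) := ENNReal.mul_rpow_of_nonneg _ _ (by positivity)
              _ ≤ _ := by gcongr; exact le_self_add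
      _ = _ := by ring



lemma rearrR_anti (f : ℝ → ℝ) {s t : ℝ} (h : s ≤ t) :
    rearrR torusMeasure f t ≤ rearrR torusMeasure f s := by
  unfold rearrR rearr
  apply sInf_le_sInf
  intro l hl
  exact le_trans hl (ENNReal.ofReal_le_ofReal h)

lemma rearrR_meas (f : ℝ → ℝ) (t : ℝ) :
    torusMeasure {x | rearrR torusMeasure f t < ENNReal.ofReal |f x|} ≤ ENNReal.ofReal t := by
  set A := {l : ℝ≥0∞ | torusMeasure {x | l < ENNReal.ofReal |f x|} ≤ ENNReal.ofReal t} with hA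
  have hne : A.Nonempty := ⟨∞, by simp [hA]⟩
  obtain ⟨u, hu, hlim, hmem⟩ := exists_seq_tendsto_sInf hne (OrderBot.bddBelow A)
  have hset : {x | rearrR torusMeasure f t < ENNReal.ofReal |f x|} ⊆
      ⋃ n, {x | u n < ENNReal.ofReal |f x|} := by
    intro x hx
    have hx' : sInf A < ENNReal.ofReal |f x| := hx
    have := (hlim.eventually (gt_mem_nhds hx')).exists
    simpa using this
  refine (measure_mono hset).trans ?_
  have hmono : Monotone fun n => {x | u n < ENNReal.ofReal |f x|} := by
    intro m n hmn x hx
    exact lt_of_le_of_lt (hu hmn) hx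
  rw [hmono.measure_iUnion]
  exact iSup_le fun n => hmem n

lemma rearrR_le {f : ℝ → ℝ} {t : ℝ} {l : ℝ≥0∞}
    (h : torusMeasure {x | l < ENNReal.ofReal |f x|} ≤ ENNReal.ofReal t) :
    rearrR torusMeasure f t ≤ l := sInf_le h

/-- discretised rearrangement -/
def Xseq (p : ℝ) (g : ℝ → ℝ) (i : ℕ) : ℝ≥0∞ :=
  ENNReal.ofReal ((2:ℝ) ^ (-(i:ℝ) / p)) * rearrR torusMeasure g ((1/2 : ℝ) ^ i)

lemma half_pow_rpow (i : ℕ) (p : ℝ) : ((1/2:ℝ) ^ i) ^ (1 / p) = (2:ℝ) ^ (-(i:ℝ) / p) := by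
  rw [← Real.rpow_natCast, one_div (2:ℝ), Real.inv_rpow (by norm_num), ← Real.rpow_neg (by norm_num),
    ← Real.rpow_mul (by norm_num)]
  congr 1; ring

lemma Ioo_sub_iUnion : Ioo (0:ℝ) 1 ⊆ ⋃ i : ℕ, Ico ((1/2:ℝ) ^ (i+1)) ((1/2:ℝ) ^ i) := by
  intro t ht
  have hex : ∃ i : ℕ, (1/2:ℝ) ^ (i+1) ≤ t := by
    obtain ⟨n, hn⟩ := exists_pow_lt_of_lt_one ht.1 (by norm_num : (1/2:ℝ) < 1)
    refine ⟨n, le_trans ?_ hn.le⟩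
    exact pow_le_pow_of_le_one (by norm_num) (by norm_num) (Nat.le_succ n)
  classical
  refine mem_iUnion.2 ⟨Nat.find hex, Nat.find_spec hex, ?_⟩
  rcases Nat.eq_zero_or_pos (Nat.find hex) with h | h
  · rw [h]; simpa using ht.2
  · have := Nat.find_min hex (m := Nat.find hex - 1) (by omega)
    rw [Nat.sub_add_cancel h] at this
    linarith

lemma lorentz_le {p : ℝ} (hp : 1 < p) {q : ℝ≥0∞} (hq : 0 < q) (g : ℝ → ℝ) :
    lorentzT g p q ≤ ENNReal.ofReal ((2:ℝ) ^ (1/p)) * ellq q (Xseq p g) := by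
  have hp0 : 0 < p := by linarith
  have hpt : ∀ (i : ℕ) (t : ℝ), t ∈ Ico ((1/2:ℝ) ^ (i+1)) ((1/2:ℝ) ^ i) →
      ENNReal.ofReal (t ^ (1 / p)) * rearrR torusMeasure g t ≤
        ENNReal.ofReal ((2:ℝ) ^ (1/p)) * Xseq p g (i+1) := by
    intro i t ht
    have ht0 : 0 < t := lt_of_lt_of_le (by positivity) ht.1
    unfold Xseq
    rw [← mul_assoc, ← ENNReal.ofReal_mul (by positivity)]
    gcongr
    · calc t ^ (1/p) ≤ ((1/2:ℝ) ^ i) ^ (1/p) := by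
            apply Real.rpow_le_rpow ht0.le ht.2.le (by positivity)
        _ = _ := by
            rw [half_pow_rpow, ← Real.rpow_add two_pos]
            congr 1
            push_cast
            field_simp
            ring
    · exact rearrR_anti g ht.1
  unfold lorentzT qnorm
  by_cases h : q = ∞
  · simp only [h, if_true, ellq]
    refine iSup₂_le fun t ht => ?_
    obtain ⟨i, hi⟩ := mem_iUnion.1 (Ioo_sub_iUnion ht)
    refine (hpt i t hi).trans ?_
    gcongr
    exact le_iSup (Xseq p g) (i+1)
  · have hr : 0 < q.toReal := ENNReal.toReal_pos hq.ne' h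
    simp only [h, if_false, ellq]
    set r := q.toReal
    have e1 : ENNReal.ofReal ((2:ℝ) ^ (1/p)) = (ENNReal.ofReal ((2:ℝ) ^ (1/p)) ^ r) ^ (1/r) := by
      rw [← ENNReal.rpow_mul, mul_one_div_cancel hr.ne', ENNReal.rpow_one]
    rw [e1, ← ENNReal.mul_rpow_of_nonneg _ _ (by positivity)]
    gcongr
    calc _ ≤ ∫⁻ t in ⋃ i : ℕ, Ico ((1/2:ℝ) ^ (i+1)) ((1/2:ℝ) ^ i),
          (ENNReal.ofReal (t ^ (1 / p)) * rearrR torusMeasure g t) ^ r / ENNReal.ofReal t :=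
          lintegral_mono_set Ioo_sub_iUnion
      _ ≤ ∑' i : ℕ, ∫⁻ t in Ico ((1/2:ℝ) ^ (i+1)) ((1/2:ℝ) ^ i),
          (ENNReal.ofReal (t ^ (1 / p)) * rearrR torusMeasure g t) ^ r / ENNReal.ofReal t :=
          lintegral_iUnion_le _ _
      _ ≤ ∑' i : ℕ, ENNReal.ofReal ((2:ℝ) ^ (1/p)) ^ r * Xseq p g (i+1) ^ r := by
          refine ENNReal.tsum_le_tsum fun i => ?_
          have hpos : (0:ℝ) < (1/2:ℝ)^(i+1) := by positivity
          calc _ ≤ ∫⁻ t in Ico ((1/2:ℝ) ^ (i+1)) ((1/2:ℝ) ^ i),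
                (ENNReal.ofReal ((2:ℝ) ^ (1/p)) * Xseq p g (i+1)) ^ r /
                  ENNReal.ofReal ((1/2:ℝ)^(i+1)) := by
                refine setLIntegral_mono' measurableSet_Ico fun t ht => ?_
                exact ENNReal.div_le_div (ENNReal.rpow_le_rpow (hpt i t ht) hr.le)
                  (ENNReal.ofReal_le_ofReal ht.1)
            _ = _ := by
                rw [setLIntegral_const, Real.volume_Ico, ← ENNReal.mul_rpow_of_nonneg _ _ hr.le]
                have : (1/2:ℝ)^i - (1/2:ℝ)^(i+1) = (1/2:ℝ)^(i+1) := by rw [pow_succ]; ring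
                rw [this, ENNReal.div_mul_cancel]
                · simp
                · simp
      _ ≤ _ := by
          rw [ENNReal.tsum_mul_left]
          refine mul_le_mul' le_rfl ?_
          exact ENNReal.tsum_comp_le_tsum_of_injective (add_left_injective 1)
            (fun i => Xseq p g i ^ r)

lemma le_lorentz {p : ℝ} (hp : 1 < p) {q : ℝ≥0∞} (hq : 0 < q) :
    ∃ C : ℝ≥0∞, C ≠ ∞ ∧ ∀ g : ℝ → ℝ, ellq q (Xseq p g) ≤ C * lorentzT g p q := by
  have hp0 : 0 < p := by linarith
  have hpt : ∀ (g : ℝ → ℝ) (i : ℕ) (t : ℝ), t ∈ Ico ((1/2:ℝ) ^ (i+1)) ((1/2:ℝ) ^ i) →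
      Xseq p g i ≤ ENNReal.ofReal ((2:ℝ) ^ (1/p)) *
        (ENNReal.ofReal (t ^ (1 / p)) * rearrR torusMeasure g t) := by
    intro g i t ht
    have ht0 : 0 < t := lt_of_lt_of_le (by positivity) ht.1
    unfold Xseq
    rw [← mul_assoc, ← ENNReal.ofReal_mul (by positivity)]
    gcongr
    · calc (2:ℝ) ^ (-(i:ℝ)/p) = (2:ℝ) ^ (1/p) * ((1/2:ℝ) ^ (i+1)) ^ (1/p) := by
            rw [half_pow_rpow, ← Real.rpow_add two_pos]
            congr 1
            push_cast
            field_simp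
            ring
        _ ≤ _ := by
            gcongr
            exact ht.1
    · exact rearrR_anti g ht.2.le
  have hsub : ∀ i : ℕ, Ioo ((1/2:ℝ) ^ (i+1)) ((1/2:ℝ) ^ i) ⊆ Ioo 0 1 := by
    intro i t ht
    exact ⟨lt_trans (by positivity) ht.1, lt_of_lt_of_le ht.2 (pow_le_one₀ (by norm_num) (by norm_num))⟩
  by_cases h : q = ∞
  · refine ⟨ENNReal.ofReal ((2:ℝ) ^ (1/p)), by simp, fun g => ?_⟩
    simp only [h, if_true, ellq, lorentzT, qnorm]
    refine iSup_le fun i => ?_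
    have hlt : (1/2:ℝ)^(i+1) < (1/2:ℝ)^i := pow_lt_pow_right_of_lt_one₀ (by norm_num) (by norm_num) (Nat.lt_succ_self i)
    obtain ⟨t, ht⟩ := exists_between hlt
    refine (hpt g i t ⟨ht.1.le, ht.2⟩).trans ?_
    gcongr
    exact le_iSup₂ (f := fun t (_ : t ∈ Ioo (0:ℝ) 1) => ENNReal.ofReal (t ^ (1 / p)) * rearrR torusMeasure g t) t (hsub i ht)
  · have hr : 0 < q.toReal := ENNReal.toReal_pos hq.ne' h
    set r := q.toReal with hrd
    set c := ENNReal.ofReal ((2:ℝ) ^ (1/p)) with hc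
    refine ⟨(c ^ r * 2) ^ (1/r), ?_, fun g => ?_⟩
    · refine ENNReal.rpow_ne_top_of_nonneg (by positivity) (ENNReal.mul_ne_top ?_ (by simp))
      exact ENNReal.rpow_ne_top_of_nonneg hr.le (by simp [hc])
    simp only [h, if_false, ellq, lorentzT, qnorm]
    rw [← ENNReal.mul_rpow_of_nonneg _ _ (by positivity)]
    gcongr
    have hdisj : Pairwise (Function.onFun Disjoint fun i : ℕ => Ioo ((1/2:ℝ) ^ (i+1)) ((1/2:ℝ) ^ i)) := by
      have key : ∀ m n : ℕ, m < n → Disjoint (Ioo ((1/2:ℝ) ^ (m+1)) ((1/2:ℝ) ^ m))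
          (Ioo ((1/2:ℝ) ^ (n+1)) ((1/2:ℝ) ^ n)) := by
        intro m n hmn
        rw [Set.disjoint_left]
        intro t h1 h2
        have : (1/2:ℝ)^n ≤ (1/2:ℝ)^(m+1) := pow_le_pow_of_le_one (by norm_num) (by norm_num) hmn
        linarith [h1.1, h2.2]
      intro m n hmn
      rcases lt_or_gt_of_ne hmn with h | h
      · exact key m n h
      · exact (key n m h).symm
    calc ∑' i, Xseq p g i ^ r
        ≤ ∑' i : ℕ, (c ^ r * 2) * ∫⁻ t in Ioo ((1/2:ℝ) ^ (i+1)) ((1/2:ℝ) ^ i),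
          (ENNReal.ofReal (t ^ (1 / p)) * rearrR torusMeasure g t) ^ r / ENNReal.ofReal t := by
          refine ENNReal.tsum_le_tsum fun i => ?_
          have hpos : (0:ℝ) < (1/2:ℝ)^(i+1) := by positivity
          have hpos' : (0:ℝ) < (1/2:ℝ)^i := by positivity
          rw [← lintegral_const_mul' _ _ (ENNReal.mul_ne_top (ENNReal.rpow_ne_top_of_nonneg hr.le (by simp [hc])) (by simp))]
          calc Xseq p g i ^ r = ∫⁻ t in Ioo ((1/2:ℝ) ^ (i+1)) ((1/2:ℝ) ^ i),
                2 * Xseq p g i ^ r / ENNReal.ofReal ((1/2:ℝ)^i) := by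
                rw [setLIntegral_const, Real.volume_Ioo]
                have : (1/2:ℝ)^i - (1/2:ℝ)^(i+1) = (1/2:ℝ) * (1/2:ℝ)^i := by rw [pow_succ]; ring
                rw [this, ENNReal.ofReal_mul (by norm_num), mul_comm (ENNReal.ofReal (1/2)), ← mul_assoc,
                  ENNReal.div_mul_cancel (by simp) (by simp)]
                have : ENNReal.ofReal (1/2) = 2⁻¹ := by
                  rw [one_div, ENNReal.ofReal_inv_of_pos two_pos]; simp
                rw [this, mul_comm, ← mul_assoc, ENNReal.inv_mul_cancel (by simp) (by simp), one_mul]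
            _ ≤ _ := by
                refine setLIntegral_mono' measurableSet_Ioo fun t ht => ?_
                have h1 := hpt g i t ⟨ht.1.le, ht.2⟩
                have h2 : Xseq p g i ^ r ≤ c ^ r * (ENNReal.ofReal (t ^ (1 / p)) * rearrR torusMeasure g t) ^ r := by
                  rw [← ENNReal.mul_rpow_of_nonneg _ _ hr.le]; gcongr
                calc 2 * Xseq p g i ^ r / ENNReal.ofReal ((1/2:ℝ)^i) ≤
                    2 * (c ^ r * (ENNReal.ofReal (t ^ (1 / p)) * rearrR torusMeasure g t) ^ r) / ENNReal.ofReal t := by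
                      gcongr
                      exact ht.2.le
                  _ = _ := by simp only [div_eq_mul_inv]; ring
      _ = (c ^ r * 2) * ∫⁻ t in ⋃ i : ℕ, Ioo ((1/2:ℝ) ^ (i+1)) ((1/2:ℝ) ^ i),
          (ENNReal.ofReal (t ^ (1 / p)) * rearrR torusMeasure g t) ^ r / ENNReal.ofReal t := by
          rw [ENNReal.tsum_mul_left, lintegral_iUnion (fun i => measurableSet_Ioo) hdisj]
      _ ≤ _ := by
          gcongr
          exact iUnion_subset hsub

/-- integral over a set of small measure controlled by the discretised rearrangement -/
lemma setLIntegral_le_rearr (g : ℝ → ℝ) (hg : Measurable g) (E : Set ℝ) (hE : MeasurableSet E)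
    (m : ℕ) (hm : torusMeasure E ≤ ENNReal.ofReal (2 * π * (1/2:ℝ)^m)) :
    ∫⁻ x in E, ENNReal.ofReal |g x| ∂torusMeasure ≤
      9 * ∑' i : ℕ, if m ≤ i then ENNReal.ofReal ((1/2:ℝ)^i) *
        rearrR torusMeasure g ((1/2:ℝ)^i) else 0 := by
  set R : ℕ → ℝ≥0∞ := fun i => rearrR torusMeasure g ((1/2:ℝ)^i) with hR
  have hRmono : Monotone R := fun i j hij =>
    rearrR_anti g (pow_le_pow_of_le_one (by norm_num) (by norm_num) hij)
  set F : ℕ → Set ℝ := fun i => {x | R i < ENNReal.ofReal |g x|} with hF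
  have hFm : ∀ i, MeasurableSet (F i) := fun i =>
    measurableSet_lt measurable_const (ENNReal.measurable_ofReal.comp hg.abs)
  have hFmeas : ∀ i, torusMeasure (F i) ≤ ENNReal.ofReal ((1/2:ℝ)^i) := fun i => rearrR_meas g _
  have hnull : ∀ᵐ x ∂torusMeasure, ∃ i, x ∉ F i := by
    have : torusMeasure (⋂ i, F i) = 0 := by
      refine le_antisymm ?_ zero_le
      have hlim : Tendsto (fun i : ℕ => ENNReal.ofReal ((1/2:ℝ)^i)) atTop (nhds 0) := by
        rw [← ENNReal.ofReal_zero]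
        exact ENNReal.tendsto_ofReal (tendsto_pow_atTop_nhds_zero_of_lt_one (by norm_num) (by norm_num))
      exact ge_of_tendsto' hlim fun i => (measure_mono (iInter_subset F i)).trans (hFmeas i)
    rw [ae_iff]
    convert this using 2
    ext x; simp
  have hpt : ∀ᵐ x ∂torusMeasure, E.indicator (fun x => ENNReal.ofReal |g x|) x ≤
      E.indicator (fun _ => R m) x + ∑' i : ℕ, if m ≤ i then (F i).indicator (fun _ => R (i+1)) x else 0 := by
    filter_upwards [hnull] with x hx
    by_cases hxE : x ∈ E
    · simp only [hxE, indicator_of_mem]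
      by_cases hxm : x ∈ F m
      · classical
        have hfs := Nat.find_spec hx
        set i0 := Nat.find hx with hi0
        have hlt : m < i0 := by
          by_contra hcon
          push Not at hcon
          exact hfs (lt_of_le_of_lt (hRmono hcon) hxm)
        have hmem : x ∈ F (i0 - 1) := by
          by_contra hcon
          have := Nat.find_min' hx hcon
          omega
        refine le_trans ?_ le_add_self
        refine le_trans ?_ (ENNReal.le_tsum (i0 - 1))
        have h1 : m ≤ i0 - 1 := by omega
        simp only [h1, if_true, hmem, indicator_of_mem]
        rw [Nat.sub_add_cancel (by omega)]
        exact not_lt.1 hfs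
      · exact le_trans (not_lt.1 hxm) le_self_add
    · simp [hxE]
  calc ∫⁻ x in E, ENNReal.ofReal |g x| ∂torusMeasure
      = ∫⁻ x, E.indicator (fun x => ENNReal.ofReal |g x|) x ∂torusMeasure := (lintegral_indicator hE _).symm
    _ ≤ ∫⁻ x, (E.indicator (fun _ => R m) x + ∑' i : ℕ, if m ≤ i then (F i).indicator (fun _ => R (i+1)) x else 0) ∂torusMeasure :=
        lintegral_mono_ae hpt
    _ = R m * torusMeasure E + ∑' i : ℕ, if m ≤ i then R (i+1) * torusMeasure (F i) else 0 := by
        rw [lintegral_add_left (measurable_const.indicator hE), lintegral_indicator_const hE, lintegral_tsum]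
        · congr 2
          ext i
          split_ifs
          · rw [lintegral_indicator_const (hFm i)]
          · simp
        · intro i
          split_ifs
          · exact (measurable_const.indicator (hFm i)).aemeasurable
          · exact aemeasurable_const
    _ ≤ 7 * (∑' i : ℕ, if m ≤ i then ENNReal.ofReal ((1/2:ℝ)^i) * R i else 0) +
        2 * (∑' i : ℕ, if m ≤ i then ENNReal.ofReal ((1/2:ℝ)^i) * R i else 0) := by
        refine add_le_add ?_ ?_
        · refine le_trans ?_ (mul_le_mul' le_rfl (ENNReal.le_tsum m))
          simp only [le_refl, if_true]
          rw [← mul_assoc, mul_comm]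
          gcongr
          refine hm.trans ?_
          have : (7:ℝ≥0∞) = ENNReal.ofReal 7 := by simp
          rw [this, ← ENNReal.ofReal_mul (by norm_num)]
          apply ENNReal.ofReal_le_ofReal
          gcongr
          linarith [Real.pi_lt_d2]
        · calc _ ≤ ∑' i : ℕ, 2 * (if m ≤ i + 1 then ENNReal.ofReal ((1/2:ℝ)^(i+1)) * R (i+1) else 0) := by
                refine ENNReal.tsum_le_tsum fun i => ?_
                split_ifs with h1 h2 h2
                · rw [← mul_assoc, mul_comm]
                  gcongr
                  refine (hFmeas i).trans ?_
                  have : (2:ℝ≥0∞) = ENNReal.ofReal 2 := by simp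
                  rw [this, ← ENNReal.ofReal_mul (by norm_num)]
                  apply ENNReal.ofReal_le_ofReal
                  rw [pow_succ]; linarith
                · omega
                · exact zero_le
                · simp
            _ ≤ _ := by
                rw [ENNReal.tsum_mul_left]
                refine mul_le_mul' le_rfl ?_
                exact ENNReal.tsum_comp_le_tsum_of_injective (add_left_injective 1)
                  (fun i => if m ≤ i then ENNReal.ofReal ((1/2:ℝ)^i) * R i else 0)
    _ = _ := by
        rw [← add_mul]
        congr 1
        norm_num



/-- `ρ(x) = |sin (x/2)|`, comparable with the distance to `2πℤ` -/
def rho (x : ℝ) : ℝ := |Real.sin (x / 2)|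

lemma rho_nonneg (x : ℝ) : 0 ≤ rho x := abs_nonneg _

lemma rho_le_one (x : ℝ) : rho x ≤ 1 := Real.abs_sin_le_one _

lemma rho_periodic (x : ℝ) : rho (x + 2 * π) = rho x := by
  unfold rho
  rw [add_div, mul_div_cancel_left₀ _ (by norm_num : (2:ℝ) ≠ 0), Real.sin_add_pi, abs_neg]

lemma rho_continuous : Continuous rho := by unfold rho; fun_prop

lemma rho_meas (s r : ℝ) :
    torusMeasure {x | rho (x + s) < r} ≤ ENNReal.ofReal (2 * π * r) := by
  have h2pi : 0 < 2 * π := by positivity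
  set A := {x | rho x < r} with hA
  have hAm : MeasurableSet A := measurableSet_lt rho_continuous.measurable measurable_const
  have hinv : ∀ g : AddSubgroup.zmultiples (2 * π), (fun x => g +ᵥ x) ⁻¹' A = A := by
    rintro ⟨g, hg⟩
    obtain ⟨n, rfl⟩ := AddSubgroup.mem_zmultiples_iff.1 hg
    have hper : Function.Periodic rho (2 * π) := rho_periodic
    ext x
    simp only [hA, mem_preimage, mem_setOf_eq, AddSubgroup.vadd_def, vadd_eq_add]
    rw [add_comm, hper.zsmul n x]
  have h1 : volume (A ∩ Ioc s (s + 2 * π)) = volume (A ∩ Ioc (-π) (-π + 2 * π)) :=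
    (isAddFundamentalDomain_Ioc h2pi s).measure_set_eq (isAddFundamentalDomain_Ioc h2pi (-π)) hAm hinv
  have h0 : torusMeasure {x | rho (x + s) < r} = volume (Ioo 0 (2 * π) ∩ (fun x => x + s) ⁻¹' A) := by
    unfold torusMeasure
    rw [Measure.restrict_apply' measurableSet_Ioo, inter_comm]
    rfl
  have h3 : volume (Ioo 0 (2 * π) ∩ (fun x => x + s) ⁻¹' A) ≤ volume (A ∩ Ioc s (s + 2 * π)) := by
    rw [← measure_preimage_add_right volume s (A ∩ Ioc s (s + 2 * π))]
    apply measure_mono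
    rintro x ⟨hx, hxA⟩
    exact ⟨hxA, by simp; linarith [hx.1], by simp; linarith [hx.2]⟩
  rw [h0]
  refine h3.trans ?_
  rw [h1]
  have hsub : A ∩ Ioc (-π) (-π + 2 * π) ⊆ Icc (-(π * r)) (π * r) := by
    rintro x ⟨hx, hx1, hx2⟩
    have hx' : |x / 2| ≤ π / 2 := by
      rw [abs_le]; constructor <;> linarith
    have h4 := Real.mul_abs_le_abs_sin hx'
    have h5 : |Real.sin (x/2)| < r := hx
    have h6 : |x| ≤ π * r := by
      rw [abs_div, abs_two] at h4
      have h7 : 2 / π * (|x| / 2) = |x| / π := by ring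
      rw [h7, div_le_iff₀ Real.pi_pos] at h4
      nlinarith [Real.pi_pos]
    exact abs_le.1 h6
  refine (measure_mono hsub).trans ?_
  rw [Real.volume_Icc]
  apply ENNReal.ofReal_le_ofReal
  linarith

/-- unit complex exponential -/
def ee (t : ℝ) : ℂ := Complex.exp (t * Complex.I)

lemma ee_add (s t : ℝ) : ee (s + t) = ee s * ee t := by
  unfold ee; rw [← Complex.exp_add]; congr 1; push_cast; ring

lemma ee_zero : ee 0 = 1 := by simp [ee]

lemma ee_norm (t : ℝ) : ‖ee t‖ = 1 := Complex.norm_exp_ofReal_mul_I t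

lemma ee_nat_mul (n : ℕ) (t : ℝ) : ee (n * t) = ee t ^ n := by
  unfold ee; rw [← Complex.exp_nat_mul]; congr 1; push_cast; ring

lemma ee_continuous : Continuous ee := by unfold ee; fun_prop

lemma ee_eq (t : ℝ) : ee t = (Real.cos t : ℂ) + (Real.sin t : ℂ) * Complex.I := by
  unfold ee; rw [Complex.exp_mul_I]; push_cast; rfl

lemma ee_conj (t : ℝ) : (starRingEnd ℂ) (ee t) = ee (-t) := by
  rw [ee_eq, ee_eq, map_add, map_mul, Complex.conj_ofReal, Complex.conj_ofReal, Complex.conj_I,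
    Real.cos_neg, Real.sin_neg]
  push_cast
  ring

lemma ee_int_period (n : ℤ) : ee (n * (2 * π)) = 1 := by
  unfold ee
  have : ((n * (2 * π) : ℝ) : ℂ) * Complex.I = n * (2 * π * Complex.I) := by push_cast; ring
  rw [this, Complex.exp_int_mul_two_pi_mul_I]

lemma ee_sub_one (t : ℝ) : ee t - 1 = 2 * Complex.I * (Real.sin (t / 2) : ℂ) * ee (t / 2) := by
  have h1 : ee t = ee (t/2) * ee (t/2) := by rw [← ee_add]; congr 1; ring
  have h2 : (1:ℂ) = ee (t/2) * ee (-(t/2)) := by rw [← ee_add]; simp [ee_zero]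
  rw [h1]
  nth_rw 1 [h2]
  rw [← mul_sub, ee_eq, ee_eq]
  simp only [Real.cos_neg, Real.sin_neg]
  push_cast
  ring

lemma norm_ee_sub_one (t : ℝ) : ‖ee t - 1‖ = 2 * rho t := by
  rw [ee_sub_one]; simp only [norm_mul, ee_norm, Complex.norm_I, Complex.norm_real, rho]
  simp

lemma norm_ee_sub_one_le (t : ℝ) : ‖ee t - 1‖ ≤ |t| := by
  rw [norm_ee_sub_one, rho]
  have h : |Real.sin (t/2)| ≤ |t / 2| := Real.abs_sin_le_abs
  rw [abs_div, abs_two] at h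
  linarith

lemma geom_ee_bound (m : ℕ) (x : ℝ) : ‖∑ u ∈ Finset.range m, ee x ^ u‖ * rho x ≤ 1 := by
  have h := geom_sum_mul (ee x) m
  have h2 : ‖∑ u ∈ Finset.range m, ee x ^ u‖ * ‖ee x - 1‖ = ‖ee x ^ m - 1‖ := by
    rw [← norm_mul, h]
  have h3 : ‖ee x ^ m - 1‖ ≤ 2 := by
    calc _ ≤ ‖ee x ^ m‖ + ‖(1:ℂ)‖ := norm_sub_le _ _
      _ = 2 := by rw [norm_pow, ee_norm]; norm_num
  rw [norm_ee_sub_one] at h2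
  nlinarith

lemma geom_ee_bound' (m : ℕ) (x : ℝ) : ‖∑ u ∈ Finset.range m, ee x ^ u‖ ≤ m := by
  calc _ ≤ ∑ u ∈ Finset.range m, ‖ee x ^ u‖ := norm_sum_le _ _
    _ = m := by simp [norm_pow, ee_norm]

/-- Fourier integral -/
def Four (f : ℝ → ℝ) (n : ℤ) : ℂ := ∫ x in (0:ℝ)..(2 * π), (f x : ℂ) * ee (-(n * x))

/-- shift of a Fourier-type integral for periodic functions -/
lemma four_shift (f : ℝ → ℝ) (hf : Function.Periodic f (2 * π)) (n : ℤ) (h : ℝ) :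
    Four (fun x => f (x + h)) n = ee (n * h) * Four f n := by
  unfold Four
  set F : ℝ → ℂ := fun x => (f x : ℂ) * ee (-(n * x)) with hF
  have hFp : Function.Periodic F (2 * π) := by
    intro x
    simp only [hF, hf x]
    congr 1
    have : (-(n * (x + 2 * π)) : ℝ) = -(n * x) + ((-n : ℤ) : ℝ) * (2 * π) := by push_cast; ring
    rw [this, ee_add, ee_int_period, mul_one]
  have e1 : ∀ x, (f (x + h) : ℂ) * ee (-(n * x)) = ee (n * h) * F (x + h) := by
    intro x
    simp only [hF]
    have : (-(n * x) : ℝ) = n * h + -(n * (x + h)) := by ring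
    rw [this, ee_add]; ring
  simp_rw [e1]
  rw [intervalIntegral.integral_const_mul, intervalIntegral.integral_comp_add_right]
  congr 1
  have := hFp.intervalIntegral_add_eq h 0
  simpa [add_comm] using this

lemma diff_periodic {f : ℝ → ℝ} (hf : Function.Periodic f (2 * π)) (h : ℝ) :
    Function.Periodic (diffOpT h f) (2 * π) := by
  intro x
  unfold diffOpT
  rw [hf x, add_right_comm, hf]

lemma diff_measurable {f : ℝ → ℝ} (hf : Measurable f) (h : ℝ) : Measurable (diffOpT h f) := by
  unfold diffOpT
  exact (hf.comp (measurable_add_const h)).sub hf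

lemma shift_integrable {f : ℝ → ℝ} (hf : Function.Periodic f (2 * π))
    (hi : IntervalIntegrable f volume 0 (2 * π)) (h : ℝ) :
    IntervalIntegrable (fun x => f (x + h)) volume 0 (2 * π) := by
  have h1 : IntervalIntegrable f volume (0 + h) (2 * π + h) :=
    hf.intervalIntegrable₀ (by positivity) hi _ _
  have := h1.comp_add_right h
  simpa using this

lemma diff_integrable {f : ℝ → ℝ} (hf : Function.Periodic f (2 * π))
    (hi : IntervalIntegrable f volume 0 (2 * π)) (h : ℝ) :
    IntervalIntegrable (diffOpT h f) volume 0 (2 * π) :=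
  (shift_integrable hf hi h).sub hi

lemma four_mul_integrable {f : ℝ → ℝ} (hi : IntervalIntegrable f volume 0 (2 * π)) {φ : ℝ → ℂ}
    (hφ : Continuous φ) :
    IntervalIntegrable (fun x => (f x : ℂ) * φ x) volume 0 (2 * π) := by
  have h1 : IntervalIntegrable (fun x => (f x : ℂ)) volume 0 (2 * π) :=
    ⟨hi.1.ofReal, hi.2.ofReal⟩
  exact h1.mul_continuousOn hφ.continuousOn

lemma four_diff {f : ℝ → ℝ} (hf : Function.Periodic f (2 * π))
    (hi : IntervalIntegrable f volume 0 (2 * π)) (n : ℤ) (h : ℝ) :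
    Four (diffOpT h f) n = (ee (n * h) - 1) * Four f n := by
  have hc : Continuous fun x : ℝ => ee (-(n * x)) := ee_continuous.comp (by fun_prop)
  rw [sub_mul, one_mul, ← four_shift f hf n h]
  unfold Four
  rw [← intervalIntegral.integral_sub (four_mul_integrable (shift_integrable hf hi h) hc)
    (four_mul_integrable hi hc)]
  congr 1
  ext x
  unfold diffOpT
  push_cast
  ring

lemma iter_props {f : ℝ → ℝ} (hm : Measurable f) (hf : Function.Periodic f (2 * π))
    (hi : IntervalIntegrable f volume 0 (2 * π)) (h : ℝ) (k : ℕ) :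
    Measurable (iterDiffT k h f) ∧ Function.Periodic (iterDiffT k h f) (2 * π) ∧
    IntervalIntegrable (iterDiffT k h f) volume 0 (2 * π) ∧
    ∀ n : ℤ, Four (iterDiffT k h f) n = (ee (n * h) - 1) ^ k * Four f n := by
  induction k with
  | zero => exact ⟨hm, hf, hi, fun n => by simp [iterDiffT]⟩
  | succ k ih =>
    obtain ⟨h1, h2, h3, h4⟩ := ih
    have e : iterDiffT (k+1) h f = diffOpT h (iterDiffT k h f) := by
      unfold iterDiffT; rw [Function.iterate_succ_apply']
    rw [e]
    refine ⟨diff_measurable h1 h, diff_periodic h2 h, diff_integrable h2 h3 h, fun n => ?_⟩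
    rw [four_diff h2 h3, h4, pow_succ]; ring

/-- localised analytic kernel -/
def Ker (N L : ℕ) (x : ℝ) : ℂ := ee (-(N * x)) * (∑ u ∈ Finset.range L, ee x ^ u) ^ 2

lemma Ker_continuous (N L : ℕ) : Continuous (Ker N L) := by
  unfold Ker
  have h := ee_continuous
  have h1 : Continuous fun x : ℝ => ee (-(N * x)) := ee_continuous.comp (by fun_prop)
  fun_prop

lemma Ker_expand (N L : ℕ) (x : ℝ) : Ker N L x =
    ∑ u ∈ Finset.range L, ∑ v ∈ Finset.range L, ee (-(((N - u - v : ℤ) : ℝ) * x)) := by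
  unfold Ker
  rw [sq, Finset.sum_mul_sum, Finset.mul_sum]
  refine Finset.sum_congr rfl fun u _ => ?_
  rw [Finset.mul_sum]
  refine Finset.sum_congr rfl fun v _ => ?_
  rw [← ee_nat_mul, ← ee_nat_mul, ← ee_add, ← ee_add]
  congr 1
  push_cast
  ring

lemma Ker_pair {g : ℝ → ℝ} (hi : IntervalIntegrable g volume 0 (2 * π)) (N L : ℕ) (s : ℝ) :
    ∫ x in (0:ℝ)..(2 * π), (g x : ℂ) * Ker N L (x + s) =
    ∑ u ∈ Finset.range L, ∑ v ∈ Finset.range L,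
      ee (-(((N - u - v : ℤ) : ℝ) * s)) * Four g (N - u - v) := by
  simp_rw [Ker_expand, Finset.mul_sum]
  have hcont : ∀ n : ℤ, Continuous fun x : ℝ => ee (-((n:ℝ) * (x + s))) := fun n =>
    ee_continuous.comp (by fun_prop)
  rw [intervalIntegral.integral_finsetSum]
  · refine Finset.sum_congr rfl fun u _ => ?_
    rw [intervalIntegral.integral_finsetSum]
    · refine Finset.sum_congr rfl fun v _ => ?_
      unfold Four
      rw [← intervalIntegral.integral_const_mul]
      congr 1
      ext x
      have : (-(((N - u - v : ℤ) : ℝ) * (x + s))) =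
        -(((N - u - v : ℤ) : ℝ) * s) + -(((N - u - v : ℤ) : ℝ) * x) := by ring
      rw [this, ee_add]; ring
    · intro v _
      exact four_mul_integrable hi (hcont _)
  · intro u _
    have hs := IntervalIntegrable.sum (μ := volume) (a := 0) (b := 2 * π) (Finset.range L)
      (f := fun (v : ℕ) (x : ℝ) => (g x : ℂ) * ee (-(((N - u - v : ℤ) : ℝ) * (x + s))))
      (fun v _ => four_mul_integrable hi (hcont _))
    rw [Finset.sum_fn] at hs
    exact hs

/-- the majorant `min(2^ν, 1/ρ)` -/
def Wt (ν : ℕ) (x : ℝ) : ℝ≥0∞ := min (2 ^ ν) (ENNReal.ofReal (rho x))⁻¹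

lemma enorm_le_Wt {z : ℂ} {ν : ℕ} {x c : ℝ} (h1 : ‖z‖ ≤ c * 2 ^ ν) (h2 : ‖z‖ * rho x ≤ c) :
    ‖z‖ₑ ≤ ENNReal.ofReal c * Wt ν x := by
  have hc : 0 ≤ c := le_trans (mul_nonneg (norm_nonneg _) (rho_nonneg x)) h2
  unfold Wt
  rw [← ofReal_norm]
  rcases min_cases ((2:ℝ≥0∞) ^ ν) (ENNReal.ofReal (rho x))⁻¹ with h | h
  · rw [h.1]
    have : (2:ℝ≥0∞) ^ ν = ENNReal.ofReal (2 ^ ν) := by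
      rw [ENNReal.ofReal_pow (by norm_num)]; simp
    rw [this, ← ENNReal.ofReal_mul hc]
    exact ENNReal.ofReal_le_ofReal h1
  · rw [h.1]
    have hfin : (ENNReal.ofReal (rho x))⁻¹ ≠ ∞ := (lt_of_lt_of_le h.2 le_top).ne
    have hpos : 0 < rho x := by
      rw [Ne, ENNReal.inv_eq_top] at hfin
      simpa using hfin
    rw [← ENNReal.ofReal_inv_of_pos hpos, ← ENNReal.ofReal_mul hc]
    apply ENNReal.ofReal_le_ofReal
    rwa [← div_eq_mul_inv, le_div_iff₀ hpos]

lemma Ker_bound (N L ν : ℕ) (hL : L ≤ 2 ^ ν) (x : ℝ) : ‖Ker N L x‖ₑ ≤ Wt ν x ^ 2 := by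
  unfold Ker
  rw [enorm_mul, enorm_pow]
  have h1 : ‖ee (-(N * x))‖ₑ = 1 := by rw [← ofReal_norm, ee_norm]; simp
  rw [h1, one_mul]
  gcongr
  have := enorm_le_Wt (z := ∑ u ∈ Finset.range L, ee x ^ u) (ν := ν) (x := x) (c := 1)
    (by rw [one_mul]; exact (geom_ee_bound' L x).trans (by exact_mod_cast hL)) (geom_ee_bound L x)
  simpa using this

lemma two_pow_inv (ν : ℕ) : ENNReal.ofReal ((1/2:ℝ)^ν) = ((2:ℝ≥0∞) ^ ν)⁻¹ := by
  rw [one_div, inv_pow, ENNReal.ofReal_inv_of_pos (by positivity), ENNReal.ofReal_pow (by norm_num)]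
  simp

lemma Wt_cases (ν : ℕ) (x : ℝ) : (rho x < (1/2:ℝ)^ν ∧ Wt ν x = 2 ^ ν) ∨
    (¬ rho x < (1/2:ℝ)^ν ∧ Wt (ν+1) x = Wt ν x) := by
  by_cases h : rho x < (1/2:ℝ)^ν
  · left
    refine ⟨h, min_eq_left ?_⟩
    rw [ENNReal.le_inv_iff_le_inv, ← two_pow_inv]
    exact ENNReal.ofReal_le_ofReal h.le
  · right
    refine ⟨h, ?_⟩
    have h1 : (ENNReal.ofReal (rho x))⁻¹ ≤ 2 ^ ν := by
      rw [ENNReal.inv_le_iff_inv_le, ← two_pow_inv]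
      exact ENNReal.ofReal_le_ofReal (not_lt.1 h)
    unfold Wt
    rw [min_eq_right h1, min_eq_right (h1.trans _)]
    exact pow_le_pow_right₀ (by norm_num) (Nat.le_succ ν)

lemma Wt_le (ν : ℕ) (x : ℝ) : Wt ν x ≤ 2 ^ ν := min_le_left _ _

lemma Wt_layer (ν : ℕ) (x : ℝ) : Wt ν x ≤
    1 + ∑ m ∈ Finset.range ν, {x | rho x < (1/2:ℝ)^m}.indicator (fun _ => (2:ℝ≥0∞) ^ m) x := by
  induction ν with
  | zero => simpa using Wt_le 0 x
  | succ ν ih =>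
    rw [Finset.sum_range_succ, ← add_assoc]
    rcases Wt_cases ν x with ⟨h, h2⟩ | ⟨h, h2⟩
    · rw [indicator_of_mem (by exact h)]
      calc Wt (ν+1) x ≤ 2 ^ (ν+1) := Wt_le _ _
        _ = 2 ^ ν + 2 ^ ν := by rw [pow_succ, mul_two]
        _ ≤ _ := by
          gcongr
          rw [← h2]; exact ih
    · rw [h2]
      exact ih.trans le_self_add

lemma Wt_sq_layer (ν : ℕ) (x : ℝ) : Wt ν x ^ 2 ≤
    1 + ∑ m ∈ Finset.range ν, {x | rho x < (1/2:ℝ)^m}.indicator (fun _ => 3 * (4:ℝ≥0∞) ^ m) x := by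
  induction ν with
  | zero =>
    have := Wt_le 0 x
    simp only [pow_zero] at this
    simpa using pow_le_one' this 2
  | succ ν ih =>
    rw [Finset.sum_range_succ, ← add_assoc]
    rcases Wt_cases ν x with ⟨h, h2⟩ | ⟨h, h2⟩
    · rw [indicator_of_mem (by exact h)]
      calc Wt (ν+1) x ^ 2 ≤ (2 ^ (ν+1)) ^ 2 := by gcongr; exact Wt_le _ _
        _ = (2 ^ ν) ^ 2 + 3 * 4 ^ ν := by
          rw [← pow_mul, ← pow_mul, mul_comm (ν + 1), mul_comm ν, pow_mul, pow_mul]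
          norm_num
          rw [pow_succ]; ring
        _ ≤ _ := by
          gcongr
          rw [← h2]; exact ih
    · rw [h2]
      exact ih.trans le_self_add



lemma torus_interval {E : Type*} [NormedAddCommGroup E] [NormedSpace ℝ E] (F : ℝ → E) :
    ∫ x in (0:ℝ)..(2 * π), F x = ∫ x, F x ∂torusMeasure := by
  unfold torusMeasure
  rw [intervalIntegral.integral_of_le (by positivity), restrict_Ioo_eq_restrict_Ioc]

lemma torus_univ : torusMeasure univ = ENNReal.ofReal (2 * π) := by
  unfold torusMeasure; simp

lemma geom4_le (n : ℕ) : ∑ m ∈ Finset.range (n+1), (4:ℝ≥0∞) ^ m ≤ 2 * 4 ^ n := by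
  induction n with
  | zero => simp
  | succ n ih =>
    rw [Finset.sum_range_succ]
    calc ∑ m ∈ Finset.range (n+1), (4:ℝ≥0∞) ^ m + 4 ^ (n+1) ≤ 2 * 4 ^ n + 4 ^ (n+1) := by gcongr
      _ ≤ 4 ^ (n+1) + 4 ^ (n+1) := by
        gcongr
        rw [pow_succ, mul_comm]
        gcongr
        norm_num
      _ = 2 * 4 ^ (n+1) := by ring

lemma lower_layer (g : ℝ → ℝ) (hg : Measurable g) (ν : ℕ) (s : ℝ) :
    ∫⁻ x, ENNReal.ofReal |g x| * Wt ν (x + s) ^ 2 ∂torusMeasure ≤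
      72 * ∑' i : ℕ, 4 ^ (min ν i) * (ENNReal.ofReal ((1/2:ℝ)^i) *
        rearrR torusMeasure g ((1/2:ℝ)^i)) := by
  set R : ℕ → ℝ≥0∞ := fun i => ENNReal.ofReal ((1/2:ℝ)^i) * rearrR torusMeasure g ((1/2:ℝ)^i) with hR
  set E : ℕ → Set ℝ := fun m => {x | rho (x + s) < (1/2:ℝ)^m} with hE
  have hgm : Measurable fun x => ENNReal.ofReal |g x| := ENNReal.measurable_ofReal.comp hg.abs
  have hEm : ∀ m, MeasurableSet (E m) := fun m =>
    measurableSet_lt (rho_continuous.measurable.comp (measurable_add_const s)) measurable_const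
  have hEJ : ∀ m, ∫⁻ x in E m, ENNReal.ofReal |g x| ∂torusMeasure ≤
      9 * ∑' i : ℕ, if m ≤ i then R i else 0 := fun m =>
    setLIntegral_le_rearr g hg (E m) (hEm m) m (rho_meas s _)
  have hU : ∫⁻ x, ENNReal.ofReal |g x| ∂torusMeasure ≤ 9 * ∑' i : ℕ, if 0 ≤ i then R i else 0 := by
    rw [← setLIntegral_univ]
    exact setLIntegral_le_rearr g hg univ MeasurableSet.univ 0 (by rw [torus_univ]; simp)
  have step1 : ∫⁻ x, ENNReal.ofReal |g x| * Wt ν (x + s) ^ 2 ∂torusMeasure ≤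
      ∫⁻ x, ENNReal.ofReal |g x| ∂torusMeasure + ∑ m ∈ Finset.range ν,
        (3 * 4 ^ m) * ∫⁻ x in E m, ENNReal.ofReal |g x| ∂torusMeasure := by
    calc _ ≤ ∫⁻ x, (ENNReal.ofReal |g x| + ∑ m ∈ Finset.range ν,
          (3 * 4 ^ m) * (E m).indicator (fun x => ENNReal.ofReal |g x|) x) ∂torusMeasure := by
          refine lintegral_mono fun x => ?_
          calc _ ≤ ENNReal.ofReal |g x| * (1 + ∑ m ∈ Finset.range ν,
                {x | rho x < (1/2:ℝ)^m}.indicator (fun _ => 3 * (4:ℝ≥0∞) ^ m) (x + s)) :=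
                mul_le_mul' le_rfl (Wt_sq_layer ν (x + s))
            _ = _ := by
              rw [mul_add, mul_one, Finset.mul_sum]
              congr 1
              refine Finset.sum_congr rfl fun m _ => ?_
              by_cases hx : rho (x + s) < (1/2:ℝ)^m
              · rw [indicator_of_mem (by exact hx), indicator_of_mem (by exact hx)]; ring
              · rw [indicator_of_notMem (by exact hx), indicator_of_notMem (by exact hx)]; simp
      _ = _ := by
          rw [lintegral_add_left hgm, lintegral_finsetSum]
          · congr 1
            refine Finset.sum_congr rfl fun m _ => ?_
            rw [lintegral_const_mul _ (hgm.indicator (hEm m)), lintegral_indicator (hEm m)]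
          · intro m _
            exact (hgm.indicator (hEm m)).const_mul _
  refine step1.trans ?_
  calc _ ≤ 9 * (∑' i : ℕ, if 0 ≤ i then R i else 0) + ∑ m ∈ Finset.range ν,
        (3 * 4 ^ m) * (9 * ∑' i : ℕ, if m ≤ i then R i else 0) :=
        add_le_add hU (Finset.sum_le_sum fun m _ => mul_le_mul' le_rfl (hEJ m))
    _ ≤ ∑ m ∈ Finset.range (ν+1), (9 * 4 ^ m) * (∑' i : ℕ, if m ≤ i then R i else 0) +
        ∑ m ∈ Finset.range (ν+1), (27 * 4 ^ m) * (∑' i : ℕ, if m ≤ i then R i else 0) := by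
        refine add_le_add ?_ ?_
        · refine le_trans ?_ (Finset.single_le_sum (f := fun m => (9 * 4 ^ m) * (∑' i : ℕ, if m ≤ i then R i else 0)) (fun _ _ => zero_le) (Finset.mem_range.2 (Nat.succ_pos ν)))
          simp
        · refine le_trans (le_of_eq ?_) (Finset.sum_le_sum_of_subset (Finset.range_subset_range.2 (Nat.le_succ ν)))
          refine Finset.sum_congr rfl fun m _ => ?_
          ring
    _ = 36 * ∑ m ∈ Finset.range (ν+1), 4 ^ m * (∑' i : ℕ, if m ≤ i then R i else 0) := by
        rw [← Finset.sum_add_distrib, Finset.mul_sum]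
        refine Finset.sum_congr rfl fun m _ => ?_
        ring
    _ = 36 * ∑' i : ℕ, (∑ m ∈ Finset.range (ν+1), if m ≤ i then 4 ^ m else 0) * R i := by
        congr 1
        simp_rw [← ENNReal.tsum_mul_left]
        rw [← Summable.tsum_finsetSum (fun _ _ => ENNReal.summable)]
        congr 1; ext i
        rw [Finset.sum_mul]
        refine Finset.sum_congr rfl fun m _ => ?_
        split_ifs <;> simp
    _ ≤ 36 * ∑' i : ℕ, (2 * 4 ^ (min ν i)) * R i := by
        refine mul_le_mul' le_rfl (ENNReal.tsum_le_tsum fun i => mul_le_mul' ?_ le_rfl)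
        refine le_trans ?_ (geom4_le (min ν i))
        rw [← Finset.sum_filter]
        apply Finset.sum_le_sum_of_subset
        intro m hm
        simp at hm ⊢
        omega
    _ = _ := by
        simp_rw [mul_assoc]
        rw [ENNReal.tsum_mul_left, ← mul_assoc]
        congr 1; norm_num

/-- the decay parameter -/
def thetaP (p : ℝ) : ℝ≥0∞ := ENNReal.ofReal ((2:ℝ) ^ (-(min (1/p) (1 - 1/p))))

lemma thetaP_lt {p : ℝ} (hp : 1 < p) : thetaP p < 1 := by
  unfold thetaP
  rw [← ENNReal.ofReal_one]
  rw [ENNReal.ofReal_lt_ofReal_iff one_pos]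
  apply Real.rpow_lt_one_of_one_lt_of_neg (by norm_num)
  have h1 : 0 < 1/p := by positivity
  have h2 : 1/p < 1 := by rw [div_lt_one (by linarith)]; exact hp
  have : 0 < min (1/p) (1 - 1/p) := lt_min h1 (by linarith)
  linarith

lemma gker_theta (p : ℝ) (m n : ℕ) : gker (thetaP p) m n =
    ENNReal.ofReal ((2:ℝ) ^ (-(min (1/p) (1 - 1/p)) * |(m:ℝ) - n|)) := by
  unfold gker thetaP
  rw [← ENNReal.ofReal_pow (by positivity), Real.rpow_mul (by norm_num), ← Real.rpow_natCast]
  congr 2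
  rw [Nat.cast_natAbs]
  push_cast
  rfl

lemma lower_kernel {p : ℝ} (hp : 1 < p) (g : ℝ → ℝ) (ν i : ℕ) :
    4 ^ (min ν i) * (ENNReal.ofReal ((1/2:ℝ)^i) * rearrR torusMeasure g ((1/2:ℝ)^i)) ≤
    ENNReal.ofReal ((4:ℝ) ^ ν * (2:ℝ) ^ (-((ν:ℝ) * (1 - 1/p)))) *
      (gker (thetaP p) ν i * Xseq p g i) := by
  have h1 : 0 < 1/p := by positivity
  have h2 : 1/p < 1 := by rw [div_lt_one (by linarith)]; exact hp
  rw [gker_theta]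
  unfold Xseq
  have e4 : (4:ℝ≥0∞) ^ (min ν i) = ENNReal.ofReal ((2:ℝ) ^ (2 * (min ν i : ℝ))) := by
    rw [Real.rpow_mul (by norm_num)]
    have : ((min (ν:ℝ) (i:ℝ))) = ((min ν i : ℕ) : ℝ) := by push_cast; rfl
    rw [this, Real.rpow_natCast, ENNReal.ofReal_pow (by positivity)]
    norm_num
  have e5 : (4:ℝ) ^ ν = (2:ℝ) ^ (2 * (ν:ℝ)) := by
    rw [Real.rpow_mul (by norm_num), Real.rpow_natCast]; norm_num
  have e6 : (1/2:ℝ)^i = (2:ℝ) ^ (-(i:ℝ)) := by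
    rw [Real.rpow_neg (by norm_num), Real.rpow_natCast]; simp
  have e7 : ENNReal.ofReal ((1/2:ℝ)^i) = ENNReal.ofReal ((2:ℝ) ^ (-(i:ℝ))) := by rw [e6]
  rw [e4, e7, e5]
  simp only [← mul_assoc]
  refine mul_le_mul' ?_ le_rfl
  rw [← ENNReal.ofReal_mul (by positivity), ← ENNReal.ofReal_mul (by positivity),
    ← ENNReal.ofReal_mul (by positivity)]
  apply ENNReal.ofReal_le_ofReal
  simp only [← Real.rpow_add two_pos]
  apply Real.rpow_le_rpow_of_exponent_le (by norm_num)
  set δ := min (1/p) (1 - 1/p) with hδ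
  have hd1 : δ ≤ 1/p := min_le_left _ _
  have hd2 : δ ≤ 1 - 1/p := min_le_right _ _
  have e8 : -(i:ℝ)/p = -(i:ℝ) * (1/p) := by ring
  rw [e8]
  set P := 1/p
  rcases le_total ν i with h | h
  · have h' : (ν:ℝ) ≤ i := by exact_mod_cast h
    rw [min_eq_left h', abs_of_nonpos (by linarith)]
    nlinarith
  · have h' : (i:ℝ) ≤ ν := by exact_mod_cast h
    rw [min_eq_right h', abs_of_nonneg (by linarith)]
    nlinarith

lemma gm_le {C : ℝ} {a : ℕ → ℝ} (ha : ∀ n, 0 ≤ a n) (hg : GMSeq C a) {n m : ℕ} (hn : 1 ≤ n)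
    (h1 : n ≤ m) (h2 : m ≤ 2 * n) : a m ≤ (1 + C) * a n := by
  have h := hg n hn
  rw [abs_of_nonneg (ha n)] at h
  have h3 : ∑ ν ∈ Finset.Ico n m, |a ν - a (ν + 1)| ≤ C * a n :=
    le_trans (Finset.sum_le_sum_of_subset_of_nonneg (Finset.Ico_subset_Ico_right h2)
      (fun _ _ _ => abs_nonneg _)) h
  have h4 : a m - a n ≤ ∑ ν ∈ Finset.Ico n m, |a ν - a (ν + 1)| := by
    rw [← Finset.sum_Ico_sub a h1]
    refine Finset.sum_le_sum fun ν _ => ?_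
    rw [abs_sub_comm]; exact le_abs_self _
  linarith

lemma norm_ge_half (A B : ℝ) (hA : 0 ≤ A) (hB : 0 ≤ B) :
    (A + B) / 2 ≤ ‖(A : ℂ) - Complex.I * B‖ := by
  have h1 := Complex.abs_re_le_norm ((A : ℂ) - Complex.I * B)
  have h2 := Complex.abs_im_le_norm ((A : ℂ) - Complex.I * B)
  simp at h1 h2
  rw [abs_of_nonneg hA] at h1
  rw [abs_of_nonneg hB] at h2
  linarith

/-- the length of the kernels -/
def LL (N : ℕ) : ℕ := (N + 3) / 4

lemma LL_le (ν : ℕ) : LL (2 ^ ν) ≤ 2 ^ ν := by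
  have : 1 ≤ 2 ^ ν := Nat.one_le_two_pow
  unfold LL; omega

lemma LL_ge (N : ℕ) : (N:ℝ) / 4 ≤ LL N := by
  have : N ≤ 4 * LL N := by unfold LL; omega
  have : (N:ℝ) ≤ 4 * LL N := by exact_mod_cast this
  linarith

lemma LL_index {N u v : ℕ} (hN : 1 ≤ N) (hu : u < LL N) (hv : v < LL N) :
    u + v ≤ N ∧ 1 ≤ N - u - v ∧ N ≤ 2 * (N - u - v) ∧
      ((N:ℤ) - u - v = ((N - u - v : ℕ) : ℤ)) := by
  unfold LL at hu hv; omega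

lemma sum_lower {C : ℝ} (hC : 0 < C) {a b : ℕ → ℝ} (ha : ∀ n, 0 ≤ a n) (hb : ∀ n, 0 ≤ b n)
    (hga : GMSeq C a) (hgb : GMSeq C b) {N : ℕ} (hN : 1 ≤ N) (σ : ℕ → ℝ)
    (hσ : ∀ u v, u < LL N → v < LL N → 0 ≤ σ (N - u - v)) :
    (a N + b N) / (2 * (1 + C)) * ∑ u ∈ Finset.range (LL N), ∑ v ∈ Finset.range (LL N), σ (N - u - v)
    ≤ ‖∑ u ∈ Finset.range (LL N), ∑ v ∈ Finset.range (LL N),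
      (σ (N - u - v) : ℂ) * ((a (N - u - v) : ℂ) - Complex.I * b (N - u - v))‖ := by
  set A := ∑ u ∈ Finset.range (LL N), ∑ v ∈ Finset.range (LL N), σ (N - u - v) * a (N - u - v) with hA
  set B := ∑ u ∈ Finset.range (LL N), ∑ v ∈ Finset.range (LL N), σ (N - u - v) * b (N - u - v) with hB
  have hA0 : 0 ≤ A := Finset.sum_nonneg fun u hu => Finset.sum_nonneg fun v hv =>
    mul_nonneg (hσ u v (Finset.mem_range.1 hu) (Finset.mem_range.1 hv)) (ha _)
  have hB0 : 0 ≤ B := Finset.sum_nonneg fun u hu => Finset.sum_nonneg fun v hv =>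
    mul_nonneg (hσ u v (Finset.mem_range.1 hu) (Finset.mem_range.1 hv)) (hb _)
  have e : ∑ u ∈ Finset.range (LL N), ∑ v ∈ Finset.range (LL N),
      (σ (N - u - v) : ℂ) * ((a (N - u - v) : ℂ) - Complex.I * b (N - u - v)) =
      (A : ℂ) - Complex.I * B := by
    rw [hA, hB]
    push_cast
    simp only [Finset.mul_sum]
    rw [← Finset.sum_sub_distrib]
    refine Finset.sum_congr rfl fun u _ => ?_
    rw [← Finset.sum_sub_distrib]
    refine Finset.sum_congr rfl fun v _ => ?_
    ring
  rw [e]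
  refine le_trans ?_ (norm_ge_half A B hA0 hB0)
  have h1C : 0 < 1 + C := by linarith
  rw [Finset.mul_sum, hA, hB, ← Finset.sum_add_distrib, Finset.sum_div]
  refine Finset.sum_le_sum fun u hu => ?_
  rw [Finset.mul_sum, ← Finset.sum_add_distrib, Finset.sum_div]
  refine Finset.sum_le_sum fun v hv => ?_
  have hu' := Finset.mem_range.1 hu
  have hv' := Finset.mem_range.1 hv
  obtain ⟨_, h1, h2, _⟩ := LL_index hN hu' hv'
  have g1 := gm_le ha hga h1 (by omega) h2
  have g2 := gm_le hb hgb h1 (by omega) h2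
  have hs := hσ u v hu' hv'
  rw [div_mul_eq_mul_div, div_le_div_iff₀ (by positivity) (by norm_num)]
  nlinarith [mul_le_mul_of_nonneg_left g1 hs, mul_le_mul_of_nonneg_left g2 hs]


lemma four_coef {f : ℝ → ℝ} {A B : ℝ} (hi : IntervalIntegrable f volume 0 (2 * π)) (n : ℕ)
    (h1 : (∫ x in Set.Ioo 0 (2 * π), f x * Real.cos (n * x)) = π * A)
    (h2 : (∫ x in Set.Ioo 0 (2 * π), f x * Real.sin (n * x)) = π * B) :
    Four f n = π * ((A : ℂ) - Complex.I * B) := by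
  have i1 : IntervalIntegrable (fun x => ((f x * Real.cos (n * x) : ℝ) : ℂ)) volume 0 (2 * π) := by
    have := four_mul_integrable hi (φ := fun x => (Real.cos (n * x) : ℂ)) (by fun_prop)
    refine this.congr ?_
    intro x _; push_cast; ring
  have i2 : IntervalIntegrable (fun x => ((f x * Real.sin (n * x) : ℝ) : ℂ)) volume 0 (2 * π) := by
    have := four_mul_integrable hi (φ := fun x => (Real.sin (n * x) : ℂ)) (by fun_prop)
    refine this.congr ?_
    intro x _; push_cast; ring
  have e1 : ∫ x in (0:ℝ)..(2*π), ((f x * Real.cos (n * x) : ℝ) : ℂ) = ((π * A : ℝ) : ℂ) := by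
    rw [intervalIntegral.integral_ofReal, torus_interval]
    unfold torusMeasure
    rw [h1]
  have e2 : ∫ x in (0:ℝ)..(2*π), ((f x * Real.sin (n * x) : ℝ) : ℂ) = ((π * B : ℝ) : ℂ) := by
    rw [intervalIntegral.integral_ofReal, torus_interval]
    unfold torusMeasure
    rw [h2]
  have : Four f n = ∫ x in (0:ℝ)..(2*π), (((f x * Real.cos (n * x) : ℝ) : ℂ) -
      Complex.I * ((f x * Real.sin (n * x) : ℝ) : ℂ)) := by
    unfold Four
    congr 1
    funext x
    rw [ee_eq, Real.cos_neg, Real.sin_neg]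
    push_cast
    ring
  rw [this, intervalIntegral.integral_sub i1 (i2.const_mul _),
    intervalIntegral.integral_const_mul, e1, e2]
  push_cast
  ring

lemma pair_bound (g : ℝ → ℝ) {N L ν : ℕ} (hL : L ≤ 2 ^ ν) (s : ℝ) :
    ‖∫ x in (0:ℝ)..(2 * π), (g x : ℂ) * Ker N L (x + s)‖ₑ ≤
      ∫⁻ x, ENNReal.ofReal |g x| * Wt ν (x + s) ^ 2 ∂torusMeasure := by
  rw [torus_interval]
  refine (enorm_integral_le_lintegral_enorm _).trans (lintegral_mono fun x => ?_)
  rw [enorm_mul]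
  refine mul_le_mul' ?_ (Ker_bound N L ν hL (x + s))
  rw [← ofReal_norm, Complex.norm_real, Real.norm_eq_abs]

/-- constant in the lower estimate -/
def lowC (k : ℕ) (C : ℝ) : ℝ := (1/32)^k / (128 * (1 + C))

lemma lower_small {f : ℝ → ℝ} {a b : ℕ → ℝ} (hm : Measurable f)
    (hf : Function.Periodic f (2 * π)) (hi : IntervalIntegrable f volume 0 (2 * π))
    {C : ℝ} (hC : 0 < C) (ha : ∀ n, 0 ≤ a n) (hb : ∀ n, 0 ≤ b n)
    (hga : GMSeq C a) (hgb : GMSeq C b)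
    (hF : ∀ n : ℕ, 1 ≤ n → Four f n = π * ((a n : ℂ) - Complex.I * b n))
    (k j ν : ℕ) (hν : ν ≤ j) :
    ENNReal.ofReal (lowC k C * ((4:ℝ) ^ ν * tauF k j ν * (a (2 ^ ν) + b (2 ^ ν)))) ≤
      ∫⁻ x, ENNReal.ofReal |iterDiffT k ((1/2:ℝ)^j) f x| *
        Wt ν (x + k * ((1/2:ℝ)^j / 2)) ^ 2 ∂torusMeasure := by
  set h : ℝ := (1/2:ℝ)^j with hh
  have hh0 : 0 < h := by positivity
  obtain ⟨-, -, hgi, hgF⟩ := iter_props hm hf hi h k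
  set N := 2 ^ ν with hN
  have hN1 : 1 ≤ N := Nat.one_le_two_pow
  have hNh : (N:ℝ) * h = 2 ^ ν / 2 ^ j := by
    rw [hN, hh, one_div, inv_pow]; push_cast; rw [div_eq_mul_inv]
  have hNh1 : (N:ℝ) * h ≤ 1 := by
    rw [hNh, div_le_one (by positivity)]
    exact pow_le_pow_right₀ (by norm_num) hν
  set σ : ℕ → ℝ := fun n => (2 * Real.sin (n * h / 2)) ^ k with hσ
  have hσb : ∀ u v, u < LL N → v < LL N → (1/4)^k * tauF k j ν ≤ σ (N - u - v) := by
    intro u v hu hv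
    obtain ⟨q1, q2, q3, q4⟩ := LL_index hN1 hu hv
    have q5 : N - u - v ≤ N := by omega
    set n := N - u - v
    have r3 : (N:ℝ) ≤ 2 * n := by exact_mod_cast q3
    have r5 : (n:ℝ) ≤ N := by exact_mod_cast q5
    have hp3 := Real.pi_gt_three
    have hp4 := Real.pi_lt_four
    have r6 : (n:ℝ) * h ≤ N * h := by gcongr
    have r7 : (N:ℝ) * h ≤ 2 * (n * h) := by
      rw [← mul_assoc]; gcongr
    have hs := Real.mul_le_sin (x := n * h / 2) (by positivity) (by linarith)
    have hs2 : (1/4) * (N * h) ≤ 2 * Real.sin (n * h / 2) := by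
      have : 1/4 ≤ 1/π := one_div_le_one_div_of_le Real.pi_pos hp4.le
      have h3 : 1/4 * (N*h) ≤ 1/π * (2 * (n*h)) := by gcongr
      have h4 : 2 / π * (n * h / 2) = 1/π * (n*h) := by ring
      linarith
    rw [tauF_low hν, ← hNh, ← mul_pow]
    exact pow_le_pow_left₀ (by positivity) hs2 k
  have hkey := pair_bound (iterDiffT k h f) (N := N) (LL_le ν) (k * (h / 2))
  refine le_trans ?_ hkey
  rw [Ker_pair hgi]
  have hsum : ∑ u ∈ Finset.range (LL N), ∑ v ∈ Finset.range (LL N),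
      ee (-(((N - u - v : ℤ) : ℝ) * (k * (h / 2)))) * Four (iterDiffT k h f) (N - u - v) =
      (Complex.I ^ k * π) * ∑ u ∈ Finset.range (LL N), ∑ v ∈ Finset.range (LL N),
      (σ (N - u - v) : ℂ) * ((a (N - u - v) : ℂ) - Complex.I * b (N - u - v)) := by
    rw [Finset.mul_sum]
    refine Finset.sum_congr rfl fun u hu => ?_
    rw [Finset.mul_sum]
    refine Finset.sum_congr rfl fun v hv => ?_
    obtain ⟨q1, q2, q3, q4⟩ := LL_index hN1 (Finset.mem_range.1 hu) (Finset.mem_range.1 hv)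
    rw [hgF, q4, hF _ q2]
    generalize N - u - v = n
    have : ee (-((((n:ℕ):ℤ) : ℝ) * (k * (h / 2)))) * (ee ((((n:ℕ):ℤ):ℝ) * h) - 1) ^ k = Complex.I ^ k * (σ n : ℂ) := by
      rw [ee_sub_one, mul_pow, ← ee_nat_mul]
      have : ee (-((((n:ℕ):ℤ) : ℝ) * (k * (h / 2)))) * ee (k * ((((n:ℕ):ℤ):ℝ) * h / 2)) = 1 := by
        rw [← ee_add, ← ee_zero]; congr 1; ring
      calc _ = (ee (-((((n:ℕ):ℤ) : ℝ) * (k * (h / 2)))) * ee (k * ((((n:ℕ):ℤ):ℝ) * h / 2))) *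
            (2 * Complex.I * (Real.sin ((((n:ℕ):ℤ):ℝ) * h / 2) : ℂ)) ^ k := by ring
        _ = _ := by
          rw [this, one_mul, hσ]
          push_cast
          rw [← mul_pow]
          congr 1
          ring
    rw [← mul_assoc, this]
    ring
  rw [hsum, ← ofReal_norm]
  apply ENNReal.ofReal_le_ofReal
  rw [norm_mul, norm_mul, norm_pow, Complex.norm_I, one_pow, one_mul, Complex.norm_real,
    Real.norm_eq_abs, abs_of_pos Real.pi_pos]
  have hτ := tauF_nonneg k j ν
  have hlow := sum_lower hC ha hb hga hgb hN1 σ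
    (fun u v hu hv => le_trans (by positivity) (hσb u v hu hv))
  have hS : (4:ℝ)^ν / 16 * ((1/4)^k * tauF k j ν) ≤
      ∑ u ∈ Finset.range (LL N), ∑ v ∈ Finset.range (LL N), σ (N - u - v) := by
    calc (4:ℝ)^ν / 16 * ((1/4)^k * tauF k j ν) ≤ (LL N * LL N : ℝ) * ((1/4)^k * tauF k j ν) := by
          gcongr
          have := LL_ge N
          have e : (4:ℝ)^ν / 16 = ((N:ℝ)/4) * ((N:ℝ)/4) := by
            rw [hN]; push_cast; rw [show (4:ℝ) = 2*2 by norm_num, mul_pow]; ring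
          rw [e]; gcongr
      _ = ∑ u ∈ Finset.range (LL N), ∑ v ∈ Finset.range (LL N), ((1/4)^k * tauF k j ν) := by
          simp; ring
      _ ≤ _ := Finset.sum_le_sum fun u hu => Finset.sum_le_sum fun v hv =>
          hσb u v (Finset.mem_range.1 hu) (Finset.mem_range.1 hv)
  have hA := ha N
  have hB := hb N
  have h1 : lowC k C * ((4:ℝ) ^ ν * tauF k j ν * (a N + b N)) ≤
      (a N + b N) / (2 * (1 + C)) * ((4:ℝ)^ν / 16 * ((1/4)^k * tauF k j ν)) := by
    have : (1/32:ℝ)^k ≤ 4 * (1/4)^k := by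
      have : (1/32:ℝ)^k ≤ (1/4)^k := pow_le_pow_left₀ (by norm_num) (by norm_num) k
      have h0 : (0:ℝ) ≤ (1/4)^k := by positivity
      linarith
    calc lowC k C * ((4:ℝ) ^ ν * tauF k j ν * (a N + b N))
        ≤ (4 * (1/4)^k) / (128 * (1+C)) * ((4:ℝ) ^ ν * tauF k j ν * (a N + b N)) := by
          unfold lowC; gcongr
      _ = _ := by field_simp; ring
  refine h1.trans ?_
  refine le_trans (mul_le_mul_of_nonneg_left hS (by positivity)) (hlow.trans ?_)
  have hp3 := Real.pi_gt_three
  exact le_mul_of_one_le_left (norm_nonneg _) (by linarith)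

lemma sin_ge_eighth {x : ℝ} (h1 : 1/4 ≤ x) (h2 : x ≤ 2) : 1/8 ≤ Real.sin x := by
  have hp3 := Real.pi_gt_three
  have hp4 := Real.pi_lt_four
  have hi : 1/4 ≤ 1/π := one_div_le_one_div_of_le Real.pi_pos hp4.le
  rcases le_total x (π/2) with h | h
  · have := Real.mul_le_sin (x := x) (by linarith) h
    have : 1/4*(1/4) ≤ 1/π * x := by gcongr
    have e : 2/π * x = 2 * (1/π * x) := by ring
    linarith
  · rw [← Real.sin_pi_sub]
    have := Real.mul_le_sin (x := π - x) (by linarith) (by linarith)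
    have : 1/4*1 ≤ 1/π * (π - x) := by gcongr; linarith
    have e : 2/π * (π - x) = 2 * (1/π * (π - x)) := by ring
    linarith

lemma sin_pair (x : ℝ) : 1/8 ≤ |Real.sin x| ∨ 1/8 ≤ |Real.sin (x - 1/2)| := by
  by_contra hcon
  push Not at hcon
  have h1 : Real.sin (1/2) = Real.sin x * Real.cos (x - 1/2) - Real.cos x * Real.sin (x-1/2) := by
    rw [← Real.sin_sub]; congr 1; ring
  have h2 := sin_ge_eighth (x := 1/2) (by norm_num) (by norm_num)
  have h3 : 1/4 ≤ Real.sin (1/2) := by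
    have hp3 := Real.pi_gt_three
    have hp4 := Real.pi_lt_four
    have hi : 1/4 ≤ 1/π := one_div_le_one_div_of_le Real.pi_pos hp4.le
    have := Real.mul_le_sin (x := 1/2) (by linarith) (by linarith)
    have e : 2/π * (1/2) = 1/π := by ring
    linarith
  have h4 : |Real.sin x * Real.cos (x - 1/2)| ≤ |Real.sin x| := by
    rw [abs_mul]; exact mul_le_of_le_one_right (abs_nonneg _) (Real.abs_cos_le_one _)
  have h5 : |Real.cos x * Real.sin (x-1/2)| ≤ |Real.sin (x-1/2)| := by
    rw [abs_mul]; exact mul_le_of_le_one_left (abs_nonneg _) (Real.abs_cos_le_one _)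
  have h6 := le_abs_self (Real.sin x * Real.cos (x - 1/2))
  have h7 := neg_abs_le (Real.cos x * Real.sin (x-1/2))
  linarith [hcon.1, hcon.2]

lemma sigma_sum (k j ν : ℕ) (hν : j ≤ ν) (v : ℕ) (hv : v < LL (2 ^ ν)) :
    (1/16:ℝ)^k * (LL (2^ν) / 4) ≤ ∑ u ∈ Finset.range (LL (2^ν)),
      (2 * rho (((2^ν - u - v : ℕ):ℝ) * (1/2:ℝ)^j)) ^ (2*k) := by
  set h : ℝ := (1/2:ℝ)^j with hh
  have hh0 : 0 < h := by positivity
  have h2j : (2:ℝ)^j * h = 1 := by rw [hh, ← mul_pow]; norm_num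
  set N := 2 ^ ν with hN
  have hN1 : 1 ≤ N := Nat.one_le_two_pow
  set φ : ℕ → ℝ := fun u => (2 * rho (((N - u - v : ℕ):ℝ) * h)) ^ (2*k) with hφ
  have hφ0 : ∀ u, 0 ≤ φ u := fun u => by
    have := rho_nonneg (((N - u - v : ℕ):ℝ) * h)
    positivity
  have hgood : ∀ u, 1/8 ≤ rho (((N - u - v : ℕ):ℝ) * h) → (1/16:ℝ)^k ≤ φ u := by
    intro u hu
    simp only [hφ]
    rw [pow_mul]
    apply pow_le_pow_left₀ (by norm_num)
    nlinarith
  by_cases hs : ν ≤ j + 2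
  · have hNh : (N:ℝ) * h = 2 ^ (ν - j) := by
      rw [hN]; push_cast
      have : ν = (ν - j) + j := by omega
      rw [this, pow_add, mul_assoc, h2j]; simp
    have hNh1 : 1 ≤ (N:ℝ) * h := by rw [hNh]; exact one_le_pow₀ (by norm_num)
    have hNh4 : (N:ℝ) * h ≤ 4 := by
      rw [hNh]
      calc (2:ℝ)^(ν-j) ≤ 2^2 := pow_le_pow_right₀ (by norm_num) (by omega)
        _ = 4 := by norm_num
    calc (1/16:ℝ)^k * (LL N / 4) ≤ (1/16:ℝ)^k * LL N := by
          gcongr; linarith [Nat.cast_nonneg (α := ℝ) (LL N)]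
      _ = ∑ u ∈ Finset.range (LL N), (1/16:ℝ)^k := by simp; ring
      _ ≤ _ := by
        refine Finset.sum_le_sum fun u hu => hgood u ?_
        obtain ⟨q1, q2, q3, q4⟩ := LL_index hN1 (Finset.mem_range.1 hu) hv
        have q5 : N - u - v ≤ N := by omega
        set n := N - u - v
        have r3 : (N:ℝ) ≤ 2 * n := by exact_mod_cast q3
        have r5 : (n:ℝ) ≤ N := by exact_mod_cast q5
        have r6 : (n:ℝ) * h ≤ N * h := by gcongr
        have r7 : (N:ℝ) * h ≤ 2 * (n * h) := by
          rw [← mul_assoc]; gcongr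
        exact (sin_ge_eighth (by linarith) (by linarith)).trans (le_abs_self _)
  · have hLL : LL N = 2 ^ (ν - 2) := by
      have : N = 4 * 2 ^ (ν - 2) := by
        rw [hN, show (4:ℕ) = 2^2 by norm_num, ← pow_add]; congr 1; omega
      unfold LL; omega
    have hD : 2 * 2 ^ j ≤ LL N := by
      rw [hLL, ← pow_succ']
      exact Nat.pow_le_pow_right (by norm_num) (by omega)
    set D := 2 ^ j with hDd
    set L := LL N with hL
    have hpair : ∀ u ∈ Finset.range (L - D), (1/16:ℝ)^k ≤ φ u + φ (u + D) := by
      intro u hu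
      rw [Finset.mem_range] at hu
      obtain ⟨q1, q2, q3, q4⟩ := LL_index hN1 (show u + D < LL N by omega) hv
      have e : ((N - u - v : ℕ):ℝ) = ((N - (u + D) - v : ℕ):ℝ) + (D:ℝ) := by
        have : N - u - v = (N - (u+D) - v) + D := by omega
        exact_mod_cast this
      have e2 : (((N - (u + D) - v : ℕ):ℝ) * h) / 2 = ((N - u - v : ℕ):ℝ) * h / 2 - 1/2 := by
        rw [e, add_mul, hDd]; push_cast; rw [h2j]; ring
      rcases sin_pair (((N - u - v : ℕ):ℝ) * h / 2) with h1 | h1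
      · have := hgood u h1
        linarith [hφ0 (u + D)]
      · rw [← e2] at h1
        have := hgood (u+D) h1
        linarith [hφ0 u]
    have s1 : ∑ u ∈ Finset.range (L - D), φ u ≤ ∑ u ∈ Finset.range L, φ u :=
      Finset.sum_le_sum_of_subset_of_nonneg (Finset.range_subset_range.2 (by omega)) fun u _ _ => hφ0 u
    have s2 : ∑ u ∈ Finset.range (L - D), φ (u + D) ≤ ∑ u ∈ Finset.range L, φ u := by
      have : L = D + (L - D) := by omega
      conv_rhs => rw [this, Finset.sum_range_add]
      have h0 : 0 ≤ ∑ u ∈ Finset.range D, φ u := Finset.sum_nonneg fun u _ => hφ0 u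
      have : ∑ u ∈ Finset.range (L - D), φ (u + D) = ∑ u ∈ Finset.range (L - D), φ (D + u) :=
        Finset.sum_congr rfl fun u _ => by rw [add_comm]
      linarith
    have s3 : ((L - D : ℕ):ℝ) * (1/16:ℝ)^k ≤ ∑ u ∈ Finset.range (L - D), (φ u + φ (u+D)) := by
      calc _ = ∑ u ∈ Finset.range (L - D), (1/16:ℝ)^k := by simp
        _ ≤ _ := Finset.sum_le_sum hpair
    rw [Finset.sum_add_distrib] at s3
    have s4 : (L:ℝ)/2 ≤ ((L - D : ℕ):ℝ) := by
      have : L ≤ 2 * (L - D) := by omega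
      have : (L:ℝ) ≤ 2 * ((L - D : ℕ):ℝ) := by exact_mod_cast this
      linarith
    have s5 : (L:ℝ)/2 * (1/16:ℝ)^k ≤ ((L - D : ℕ):ℝ) * (1/16:ℝ)^k := by gcongr
    show (1/16:ℝ)^k * ((L:ℝ) / 4) ≤ ∑ u ∈ Finset.range L, φ u
    linarith



lemma mult_big (k : ℕ) (t : ℝ) : (ee (-t) - 1) ^ k * (ee t - 1) ^ k = (((2 * rho t) ^ (2*k) : ℝ) : ℂ) := by
  rw [← mul_pow, pow_mul]
  push_cast
  congr 1
  rw [ee_sub_one, ee_sub_one]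
  have h1 : ee (-t/2) * ee (t/2) = 1 := by rw [← ee_add, ← ee_zero]; congr 1; ring
  have h2 : Real.sin (-t/2) = - Real.sin (t/2) := by rw [neg_div, Real.sin_neg]
  rw [h2]
  calc _ = (4 * (Real.sin (t/2):ℂ)^2) * (ee (-t/2) * ee (t/2)) * (-(Complex.I^2)) := by push_cast; ring
    _ = 4 * ((Real.sin (t/2)^2 : ℝ):ℂ) := by rw [h1, Complex.I_sq]; push_cast; ring
    _ = _ := by rw [← sq_abs]; unfold rho; push_cast; ring

lemma lower_big {f : ℝ → ℝ} {a b : ℕ → ℝ} (hm : Measurable f)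
    (hf : Function.Periodic f (2 * π)) (hi : IntervalIntegrable f volume 0 (2 * π))
    {C : ℝ} (hC : 0 < C) (ha : ∀ n, 0 ≤ a n) (hb : ∀ n, 0 ≤ b n)
    (hga : GMSeq C a) (hgb : GMSeq C b)
    (hF : ∀ n : ℕ, 1 ≤ n → Four f n = π * ((a n : ℂ) - Complex.I * b n))
    (k j ν : ℕ) (hν : j ≤ ν) (M : ℝ≥0∞)
    (hM : ∀ s, ∫⁻ x, ENNReal.ofReal |iterDiffT k ((1/2:ℝ)^j) f x| *
        Wt ν (x + s) ^ 2 ∂torusMeasure ≤ M) :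
    ENNReal.ofReal (lowC k C * ((4:ℝ) ^ ν * tauF k j ν * (a (2 ^ ν) + b (2 ^ ν)))) ≤ M := by
  set h : ℝ := (1/2:ℝ)^j with hh
  obtain ⟨-, -, hgi, hgF⟩ := iter_props hm hf hi h k
  set N := 2 ^ ν with hN
  have hN1 : 1 ≤ N := Nat.one_le_two_pow
  set σ : ℕ → ℝ := fun n => (2 * rho (n * h)) ^ (2*k) with hσ
  set T : ℂ := ∑ l ∈ Finset.range (k+1), ((-1:ℂ)^(k-l) * (k.choose l : ℂ)) *
    ∫ x in (0:ℝ)..(2 * π), (iterDiffT k h f x : ℂ) * Ker N (LL N) (x + l * h) with hT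
  have hTM : ‖T‖ₑ ≤ 2 ^ k * M := by
    calc ‖T‖ₑ ≤ ∑ l ∈ Finset.range (k+1), ‖((-1:ℂ)^(k-l) * (k.choose l : ℂ)) *
          ∫ x in (0:ℝ)..(2 * π), (iterDiffT k h f x : ℂ) * Ker N (LL N) (x + l * h)‖ₑ :=
          enorm_sum_le _ _
      _ ≤ ∑ l ∈ Finset.range (k+1), (k.choose l : ℝ≥0∞) * M := by
          refine Finset.sum_le_sum fun l _ => ?_
          rw [enorm_mul]
          refine mul_le_mul' ?_ ((pair_bound _ (LL_le ν) _).trans (hM _))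
          rw [← ofReal_norm, norm_mul, norm_pow, norm_neg, norm_one, one_pow, one_mul,
            Complex.norm_natCast, ENNReal.ofReal_natCast]
      _ = 2 ^ k * M := by
          rw [← Finset.sum_mul]
          congr 1
          exact_mod_cast Nat.sum_range_choose k
  have hTs : T = π * ∑ u ∈ Finset.range (LL N), ∑ v ∈ Finset.range (LL N),
      (σ (N - u - v) : ℂ) * ((a (N - u - v) : ℂ) - Complex.I * b (N - u - v)) := by
    rw [hT]
    simp_rw [Ker_pair hgi, Finset.mul_sum]
    rw [Finset.sum_comm]
    refine Finset.sum_congr rfl fun u hu => ?_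
    rw [Finset.sum_comm]
    refine Finset.sum_congr rfl fun v hv => ?_
    obtain ⟨q1, q2, q3, q4⟩ := LL_index hN1 (Finset.mem_range.1 hu) (Finset.mem_range.1 hv)
    rw [hgF, q4, hF _ q2]
    generalize N - u - v = n
    have hbin : ∑ l ∈ Finset.range (k+1), ((-1:ℂ)^(k-l) * (k.choose l : ℂ)) *
        ee (-((((n:ℕ):ℤ) : ℝ) * (l * h))) = (ee (-(n * h)) - 1) ^ k := by
      rw [sub_eq_add_neg, add_pow]
      refine Finset.sum_congr rfl fun l _ => ?_
      rw [← ee_nat_mul]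
      have : (-((((n:ℕ):ℤ) : ℝ) * (l * h))) = l * (-(n*h)) := by push_cast; ring
      rw [this]; ring
    calc _ = (∑ l ∈ Finset.range (k+1), ((-1:ℂ)^(k-l) * (k.choose l : ℂ)) *
        ee (-((((n:ℕ):ℤ) : ℝ) * (l * h)))) * ((ee ((((n:ℕ):ℤ) : ℝ) * h) - 1) ^ k * (π * ((a n : ℂ) - Complex.I * b n))) := by
          rw [Finset.sum_mul]
          refine Finset.sum_congr rfl fun l _ => ?_
          ring
      _ = _ := by
          rw [hbin, ← mul_assoc]
          have := mult_big k (n * h)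
          rw [Int.cast_natCast, this]
          simp only [hσ]
          ring
  have hlow := sum_lower hC ha hb hga hgb hN1 σ
    (fun u v hu hv => by
      have := rho_nonneg (((N - u - v : ℕ):ℝ) * h)
      simp only [hσ]; positivity)
  have hS : (4:ℝ)^ν / 64 * (1/16)^k ≤
      ∑ u ∈ Finset.range (LL N), ∑ v ∈ Finset.range (LL N), σ (N - u - v) := by
    rw [Finset.sum_comm]
    calc (4:ℝ)^ν / 64 * (1/16)^k ≤ (LL N * LL N / 4 : ℝ) * (1/16)^k := by
          refine mul_le_mul_of_nonneg_right ?_ (by positivity)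
          have := LL_ge N
          have e : (4:ℝ)^ν / 64 = ((N:ℝ)/4) * ((N:ℝ)/4) / 4 := by
            rw [hN]; push_cast; rw [show (4:ℝ) = 2*2 by norm_num, mul_pow]; ring
          rw [e]; gcongr
      _ = ∑ v ∈ Finset.range (LL N), ((1/16:ℝ)^k * (LL N / 4)) := by
          simp; ring
      _ ≤ _ := Finset.sum_le_sum fun v hv => sigma_sum k j ν hν v (Finset.mem_range.1 hv)
  have hA := ha N
  have hB := hb N
  have h1 : 2 ^ k * (lowC k C * ((4:ℝ) ^ ν * tauF k j ν * (a N + b N))) ≤ ‖T‖ := by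
    rw [hTs, norm_mul, Complex.norm_real, Real.norm_eq_abs, abs_of_pos Real.pi_pos]
    have hp3 := Real.pi_gt_three
    refine le_trans ?_ (le_mul_of_one_le_left (norm_nonneg _) (by linarith))
    refine le_trans ?_ hlow
    refine le_trans ?_ (mul_le_mul_of_nonneg_left hS (by positivity))
    rw [tauF_high hν]
    unfold lowC
    have : (2:ℝ)^k * (1/32)^k = (1/16)^k := by rw [← mul_pow]; norm_num
    rw [← this]
    apply le_of_eq
    field_simp
    ring
  have h2 : 2 ^ k * ENNReal.ofReal (lowC k C * ((4:ℝ) ^ ν * tauF k j ν * (a N + b N))) ≤ 2 ^ k * M := by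
    refine le_trans ?_ hTM
    rw [← ofReal_norm]
    have e : (2:ℝ≥0∞)^k = ENNReal.ofReal (2^k) := by
      rw [ENNReal.ofReal_pow (by norm_num)]; simp
    rw [e, ← ENNReal.ofReal_mul (by positivity)]
    exact ENNReal.ofReal_le_ofReal h1
  exact (ENNReal.mul_le_mul_iff_right (by positivity) (by finiteness)).1 h2

lemma lower_all {f : ℝ → ℝ} {a b : ℕ → ℝ} (hm : Measurable f)
    (hf : Function.Periodic f (2 * π)) (hi : IntervalIntegrable f volume 0 (2 * π))
    {C : ℝ} (hC : 0 < C) (ha : ∀ n, 0 ≤ a n) (hb : ∀ n, 0 ≤ b n)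
    (hga : GMSeq C a) (hgb : GMSeq C b)
    (hF : ∀ n : ℕ, 1 ≤ n → Four f n = π * ((a n : ℂ) - Complex.I * b n))
    {p : ℝ} (hp : 1 < p) (k j ν : ℕ) :
    ENNReal.ofReal (lowC k C) * yseq k j (1 - 1/p) a b ν ≤
      ∑' i, gker (thetaP p) ν i * (72 * Xseq p (iterDiffT k ((1/2:ℝ)^j) f) i) := by
  set g := iterDiffT k ((1/2:ℝ)^j) f with hg
  have hgm : Measurable g := (iter_props hm hf hi _ k).1
  set w : ℝ := (4:ℝ) ^ ν * (2:ℝ) ^ (-((ν:ℝ) * (1 - 1/p))) with hw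
  have hw0 : 0 < w := by positivity
  set M : ℝ≥0∞ := ENNReal.ofReal w * ∑' i, gker (thetaP p) ν i * (72 * Xseq p g i) with hMd
  have hM : ∀ s, ∫⁻ x, ENNReal.ofReal |g x| * Wt ν (x + s) ^ 2 ∂torusMeasure ≤ M := by
    intro s
    refine (lower_layer g hgm ν s).trans ?_
    rw [hMd, ← ENNReal.tsum_mul_left, ← ENNReal.tsum_mul_left]
    refine ENNReal.tsum_le_tsum fun i => ?_
    refine (mul_le_mul_right (lower_kernel hp g ν i) 72).trans (le_of_eq ?_)
    ring
  have key : ENNReal.ofReal (lowC k C * ((4:ℝ) ^ ν * tauF k j ν * (a (2 ^ ν) + b (2 ^ ν)))) ≤ M := by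
    rcases le_total ν j with h | h
    · exact (lower_small hm hf hi hC ha hb hga hgb hF k j ν h).trans (hM _)
    · exact lower_big hm hf hi hC ha hb hga hgb hF k j ν h M hM
  have e : lowC k C * ((4:ℝ) ^ ν * tauF k j ν * (a (2 ^ ν) + b (2 ^ ν))) =
      w * (lowC k C * ((2:ℝ) ^ ((ν:ℝ) * (1-1/p)) * (a (2 ^ ν) + b (2 ^ ν)) * tauF k j ν)) := by
    have : (2:ℝ) ^ (-((ν:ℝ) * (1 - 1/p))) * (2:ℝ) ^ ((ν:ℝ) * (1-1/p)) = 1 := by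
      rw [← Real.rpow_add two_pos]; simp
    rw [hw]
    calc _ = ((2:ℝ) ^ (-((ν:ℝ) * (1 - 1/p))) * (2:ℝ) ^ ((ν:ℝ) * (1-1/p))) *
       (lowC k C * ((4:ℝ) ^ ν * tauF k j ν * (a (2 ^ ν) + b (2 ^ ν)))) := by rw [this, one_mul]
      _ = _ := by ring
  have hlc : 0 ≤ lowC k C := by unfold lowC; positivity
  rw [e, ENNReal.ofReal_mul hw0.le, ENNReal.ofReal_mul hlc] at key
  exact (ENNReal.mul_le_mul_iff_right (by simpa using hw0) (by finiteness)).1 key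

/-- the lower half of the theorem -/
lemma lower_final {p : ℝ} (hp : 1 < p) {q : ℝ≥0∞} (hq : 0 < q) (k : ℕ) {C : ℝ} (hC : 0 < C) :
    ∃ D : ℝ≥0∞, D ≠ ∞ ∧ ∀ (f : ℝ → ℝ) (a b : ℕ → ℝ), Measurable f →
      Function.Periodic f (2 * π) → IntervalIntegrable f volume 0 (2 * π) →
      (∀ n, 0 ≤ a n) → (∀ n, 0 ≤ b n) → GMSeq C a → GMSeq C b →
      (∀ n : ℕ, 1 ≤ n → Four f n = π * ((a n : ℂ) - Complex.I * b n)) → ∀ j : ℕ,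
      rhsT q k j (1 - 1/p) a b ≤ D * modulusT k f p q ((2:ℝ) ^ (-(j:ℝ))) := by
  obtain ⟨C1, hC1, H1⟩ := rhsT_le hq
  obtain ⟨C2, hC2, H2⟩ := ellq_young hq (thetaP p) (thetaP_lt hp)
  obtain ⟨C3, hC3, H3⟩ := le_lorentz hp hq
  have hlc : 0 < lowC k C := by unfold lowC; positivity
  set c := ENNReal.ofReal (lowC k C) with hc
  have hc0 : c ≠ 0 := by simpa [hc] using hlc
  have hci : c ≠ ∞ := by simp [hc]
  refine ⟨C1 * (c⁻¹ * (C2 * (72 * C3))), by finiteness, ?_⟩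
  intro f a b hm hf hi ha hb hga hgb hF j
  have h0 := lower_all hm hf hi hC ha hb hga hgb hF hp k j
  have h1 := H2 _ _ h0
  rw [ellq_const_mul hq, ellq_const_mul hq] at h1
  have h2 := H3 (iterDiffT k ((1/2:ℝ)^j) f)
  have h3 : lorentzT (iterDiffT k ((1/2:ℝ)^j) f) p q ≤ modulusT k f p q ((2:ℝ) ^ (-(j:ℝ))) := by
    unfold modulusT
    refine le_iSup₂_of_le ((1/2:ℝ)^j) ?_ le_rfl
    show |(1/2:ℝ)^j| ≤ _
    rw [abs_of_pos (by positivity), Real.rpow_neg (by norm_num), Real.rpow_natCast, one_div, inv_pow]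
  calc rhsT q k j (1 - 1/p) a b ≤ C1 * ellq q (yseq k j (1-1/p) a b) := H1 _ _ _ _ _ ha hb
    _ = C1 * (c⁻¹ * (c * ellq q (yseq k j (1-1/p) a b))) := by
      rw [← mul_assoc c⁻¹, ENNReal.inv_mul_cancel hc0 hci, one_mul]
    _ ≤ C1 * (c⁻¹ * (C2 * (72 * (C3 * modulusT k f p q ((2:ℝ) ^ (-(j:ℝ))))))) := by
      refine mul_le_mul_right (mul_le_mul_right (h1.trans ?_) _) _
      refine mul_le_mul_right (mul_le_mul_right (h2.trans ?_) _) _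
      exact mul_le_mul_right h3 _
    _ = _ := by ring



lemma abel_ee (d : ℕ → ℂ) (z : ℂ) (n : ℕ) : ∑ i ∈ Finset.range n, d i * z ^ i =
    d n * (∑ u ∈ Finset.range n, z ^ u) -
      ∑ i ∈ Finset.range n, (d (i+1) - d i) * ∑ u ∈ Finset.range (i+1), z ^ u := by
  induction n with
  | zero => simp
  | succ n ih =>
    rw [Finset.sum_range_succ, ih, Finset.sum_range_succ (fun i => (d (i+1) - d i) * _),
      Finset.sum_range_succ (fun u => z ^ u)]
    ring

lemma block_bound (d : ℕ → ℂ) (ν : ℕ) (V : ℝ)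
    (h1 : ∀ n, 2 ^ ν ≤ n → n ≤ 2 * 2 ^ ν → ‖d n‖ ≤ V)
    (h2 : ∑ n ∈ Finset.Ico (2^ν) (2 * 2^ν), ‖d n - d (n+1)‖ ≤ V) (x : ℝ) :
    ‖∑ n ∈ Finset.Ico (2^ν) (2 * 2^ν), d n * ee x ^ n‖ₑ ≤ ENNReal.ofReal (2 * V) * Wt ν x := by
  set M := 2 ^ ν with hM
  have hV : 0 ≤ V := (norm_nonneg _).trans (h1 M le_rfl (by omega))
  have e0 : ∑ n ∈ Finset.Ico M (2*M), d n * ee x ^ n =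
      ee x ^ M * ∑ i ∈ Finset.range M, d (M + i) * ee x ^ i := by
    rw [Finset.sum_Ico_eq_sum_range, show 2*M - M = M by omega, Finset.mul_sum]
    refine Finset.sum_congr rfl fun i _ => ?_
    rw [pow_add]; ring
  have e1 : ‖∑ n ∈ Finset.Ico M (2*M), d n * ee x ^ n‖ = ‖∑ i ∈ Finset.range M, d (M + i) * ee x ^ i‖ := by
    rw [e0, norm_mul, norm_pow, ee_norm, one_pow, one_mul]
  have h2' : ∑ i ∈ Finset.range M, ‖d (M + (i+1)) - d (M + i)‖ ≤ V := by
    rw [Finset.sum_Ico_eq_sum_range, show 2*M - M = M by omega] at h2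
    refine le_trans (le_of_eq (Finset.sum_congr rfl fun i _ => ?_)) h2
    rw [norm_sub_rev]; rfl
  apply enorm_le_Wt
  · rw [e1]
    calc _ ≤ ∑ i ∈ Finset.range M, ‖d (M + i) * ee x ^ i‖ := norm_sum_le _ _
      _ ≤ ∑ i ∈ Finset.range M, V := by
          refine Finset.sum_le_sum fun i hi => ?_
          rw [Finset.mem_range] at hi
          rw [norm_mul, norm_pow, ee_norm, one_pow, mul_one]
          exact h1 _ (by omega) (by omega)
      _ = V * 2 ^ ν := by simp [hM]; ring
      _ ≤ _ := by gcongr; linarith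
  · rw [e1, abel_ee (fun i => d (M + i))]
    set S : ℕ → ℂ := fun n => ∑ u ∈ Finset.range n, ee x ^ u with hS
    have hr := rho_nonneg x
    calc ‖d (M + M) * S M - ∑ i ∈ Finset.range M, (d (M + (i+1)) - d (M + i)) * S (i+1)‖ * rho x
        ≤ (‖d (M + M)‖ * ‖S M‖ + ∑ i ∈ Finset.range M, ‖d (M + (i+1)) - d (M + i)‖ * ‖S (i+1)‖) * rho x := by
          gcongr
          refine (norm_sub_le _ _).trans ?_
          rw [norm_mul]
          gcongr
          refine (norm_sum_le _ _).trans (le_of_eq ?_)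
          simp_rw [norm_mul]
      _ = ‖d (M + M)‖ * (‖S M‖ * rho x) + ∑ i ∈ Finset.range M, ‖d (M + (i+1)) - d (M + i)‖ * (‖S (i+1)‖ * rho x) := by
          rw [add_mul, Finset.sum_mul, mul_assoc]
          simp_rw [mul_assoc]
      _ ≤ V * 1 + ∑ i ∈ Finset.range M, ‖d (M + (i+1)) - d (M + i)‖ * 1 := by
          have hg := fun m => geom_ee_bound m x
          refine add_le_add (mul_le_mul (h1 (M + M) (Nat.le_add_left _ _) (by omega)) (hg M)
            (mul_nonneg (norm_nonneg _) hr) hV) (Finset.sum_le_sum fun i _ => ?_)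
          exact mul_le_mul_of_nonneg_left (hg (i+1)) (norm_nonneg _)
      _ ≤ 2 * V := by simp only [mul_one]; linarith

lemma pow_diff_bound (x y : ℂ) (R : ℝ) (hx : ‖x‖ ≤ R) (hy : ‖y‖ ≤ R) (k : ℕ) :
    ‖x ^ k - y ^ k‖ * R ≤ k * R ^ k * ‖x - y‖ := by
  have hR : 0 ≤ R := (norm_nonneg _).trans hx
  induction k with
  | zero => simp
  | succ k ih =>
    have e : x ^ (k+1) - y ^ (k+1) = x * (x ^ k - y ^ k) + (x - y) * y ^ k := by ring
    calc ‖x ^ (k+1) - y ^ (k+1)‖ * R ≤ (‖x‖ * ‖x ^ k - y ^ k‖ + ‖x - y‖ * ‖y‖ ^ k) * R := by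
          rw [e]; gcongr
          refine (norm_add_le _ _).trans ?_
          rw [norm_mul, norm_mul, norm_pow]
      _ = ‖x‖ * (‖x ^ k - y ^ k‖ * R) + ‖x - y‖ * ‖y‖ ^ k * R := by ring
      _ ≤ R * (k * R ^ k * ‖x - y‖) + ‖x - y‖ * R ^ k * R := by gcongr
      _ = _ := by push_cast; ring

/-- complex coefficients -/
def cc (a b : ℕ → ℝ) (n : ℕ) : ℂ := (a n : ℂ) - Complex.I * b n

/-- dyadic block -/
def Pblk (a b : ℕ → ℝ) (ν : ℕ) (x : ℝ) : ℂ :=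
  ∑ n ∈ Finset.Ico (2^ν) (2 * 2^ν), cc a b n * ee x ^ n

lemma norm_cc_le (A B : ℝ) : ‖(A : ℂ) - Complex.I * B‖ ≤ |A| + |B| := by
  refine (norm_sub_le _ _).trans ?_
  simp

section
variable {C : ℝ} {a b : ℕ → ℝ}

lemma cc_size (ha : ∀ n, 0 ≤ a n) (hb : ∀ n, 0 ≤ b n)
    (hga : GMSeq C a) (hgb : GMSeq C b) (ν n : ℕ) (h1 : 2 ^ ν ≤ n) (h2 : n ≤ 2 * 2 ^ ν) :
    ‖cc a b n‖ ≤ (1 + C) * (a (2^ν) + b (2^ν)) := by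
  have hM : 1 ≤ 2 ^ ν := Nat.one_le_two_pow
  have := norm_cc_le (a n) (b n)
  rw [abs_of_nonneg (ha n), abs_of_nonneg (hb n)] at this
  have h3 := gm_le ha hga hM h1 h2
  have h4 := gm_le hb hgb hM h1 h2
  unfold cc
  linarith

lemma cc_var (ha : ∀ n, 0 ≤ a n) (hb : ∀ n, 0 ≤ b n)
    (hga : GMSeq C a) (hgb : GMSeq C b) (ν : ℕ) :
    ∑ n ∈ Finset.Ico (2^ν) (2 * 2^ν), ‖cc a b n - cc a b (n+1)‖ ≤ C * (a (2^ν) + b (2^ν)) := by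
  have hM : 1 ≤ 2 ^ ν := Nat.one_le_two_pow
  have h3 := hga _ hM
  have h4 := hgb _ hM
  rw [abs_of_nonneg (ha _)] at h3
  rw [abs_of_nonneg (hb _)] at h4
  calc _ ≤ ∑ n ∈ Finset.Ico (2^ν) (2 * 2^ν), (|a n - a (n+1)| + |b n - b (n+1)|) := by
        refine Finset.sum_le_sum fun n _ => ?_
        have := norm_cc_le (a n - a (n+1)) (b n - b (n+1))
        refine le_trans (le_of_eq ?_) this
        unfold cc
        congr 1
        push_cast
        ring
    _ ≤ _ := by rw [Finset.sum_add_distrib]; linarith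

lemma Pblk_bound (hC : 0 < C) (ha : ∀ n, 0 ≤ a n) (hb : ∀ n, 0 ≤ b n)
    (hga : GMSeq C a) (hgb : GMSeq C b) (ν : ℕ) (x : ℝ) :
    ‖Pblk a b ν x‖ₑ ≤ ENNReal.ofReal (2 * ((1 + C) * (a (2^ν) + b (2^ν)))) * Wt ν x := by
  apply block_bound
  · exact fun n h1 h2 => cc_size ha hb hga hgb ν n h1 h2
  · refine (cc_var ha hb hga hgb ν).trans ?_
    have := ha (2^ν)
    have := hb (2^ν)
    gcongr
    linarith

/-- the multiplier block -/
lemma mult_bound (hC : 0 < C) (ha : ∀ n, 0 ≤ a n) (hb : ∀ n, 0 ≤ b n)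
    (hga : GMSeq C a) (hgb : GMSeq C b) (k j ν : ℕ) (hν : ν ≤ j) (h : ℝ) (hh : |h| ≤ (1/2:ℝ)^j) (x : ℝ) :
    ‖∑ n ∈ Finset.Ico (2^ν) (2 * 2^ν), (cc a b n * (ee h ^ n - 1) ^ k) * ee x ^ n‖ₑ ≤
      ENNReal.ofReal (2 * ((1 + C) * (k+1) * 2 ^ k * (a (2^ν) + b (2^ν)) * tauF k j ν)) * Wt ν x := by
  have hA0 : 0 ≤ a (2^ν) + b (2^ν) := add_nonneg (ha _) (hb _)
  set A := a (2^ν) + b (2^ν) with hA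
  set τ : ℝ := (2:ℝ)^ν / 2^j with hτ
  have hτ0 : 0 < τ := by positivity
  rw [tauF_low hν]
  set m : ℕ → ℂ := fun n => (ee h ^ n - 1) with hm
  have hmn : ∀ n, n ≤ 2 * 2 ^ ν → ‖m n‖ ≤ 2 * τ := by
    intro n hn
    simp only [hm]
    rw [← ee_nat_mul]
    refine (norm_ee_sub_one_le _).trans ?_
    rw [abs_mul, Nat.abs_cast]
    have : (n:ℝ) ≤ 2 * 2^ν := by exact_mod_cast hn
    calc (n:ℝ) * |h| ≤ (2 * 2^ν) * (1/2:ℝ)^j := by gcongr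
      _ = _ := by rw [hτ, one_div, inv_pow]; ring
  have hmk : ∀ n, n ≤ 2 * 2 ^ ν → ‖m n ^ k‖ ≤ 2^k * τ ^ k := by
    intro n hn
    rw [norm_pow, ← mul_pow]
    exact pow_le_pow_left₀ (norm_nonneg _) (hmn n hn) k
  have hmd : ∀ n, n + 1 ≤ 2 * 2 ^ ν → ‖m n ^ k - m (n+1) ^ k‖ * 2 ^ ν ≤ k * (2^k * τ ^ k) := by
    intro n hn
    have h1 := pow_diff_bound _ _ _ (hmn n (by omega)) (hmn (n+1) hn) k
    have h2 : ‖m n - m (n+1)‖ ≤ (1/2:ℝ)^j := by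
      have : m n - m (n+1) = - (ee h ^ n * (ee h - 1)) := by simp only [hm]; ring
      rw [this, norm_neg, norm_mul, norm_pow, ee_norm, one_pow, one_mul]
      exact (norm_ee_sub_one_le _).trans hh
    have h3 : ‖m n ^ k - m (n+1) ^ k‖ * (2 * τ) ≤ k * (2 * τ)^k * (1/2:ℝ)^j := by
      refine h1.trans ?_
      gcongr
    have h4 : ‖m n ^ k - m (n+1) ^ k‖ * (2 * τ) = (‖m n ^ k - m (n+1) ^ k‖ * 2^ν * 2) * (1/2:ℝ)^j := by
      rw [hτ, one_div, inv_pow]; ring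
    rw [h4] at h3
    have h5 := le_of_mul_le_mul_right h3 (by positivity)
    have h6 : 0 ≤ ‖m n ^ k - m (n+1) ^ k‖ * 2^ν := by positivity
    rw [mul_pow] at h5
    linarith
  apply block_bound
  · intro n h1 h2
    rw [norm_mul]
    have hc := cc_size ha hb hga hgb ν n h1 h2
    have hm' := hmk n h2
    calc ‖cc a b n‖ * ‖m n ^ k‖ ≤ ((1+C) * A) * (2^k * τ^k) := by gcongr
      _ ≤ ((1+C) * A) * (2^k * τ^k) * (k+1) := by
          apply le_mul_of_one_le_right (by positivity)
          linarith [Nat.cast_nonneg (α := ℝ) k]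
      _ = _ := by ring
  · calc ∑ n ∈ Finset.Ico (2^ν) (2 * 2^ν), ‖cc a b n * m n ^ k - cc a b (n+1) * m (n+1) ^ k‖
        ≤ ∑ n ∈ Finset.Ico (2^ν) (2 * 2^ν), (‖cc a b n - cc a b (n+1)‖ * (2^k * τ^k) +
            ((1+C) * A) * (k * (2^k * τ^k) / 2^ν)) := by
          refine Finset.sum_le_sum fun n hn => ?_
          rw [Finset.mem_Ico] at hn
          have e : cc a b n * m n ^ k - cc a b (n+1) * m (n+1) ^ k =
            (cc a b n - cc a b (n+1)) * m n ^ k + cc a b (n+1) * (m n ^ k - m (n+1)^k) := by ring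
          rw [e]
          refine (norm_add_le _ _).trans ?_
          rw [norm_mul, norm_mul]
          have q1 := hmk n (by omega)
          have q2 := cc_size ha hb hga hgb ν (n+1) (by omega) (by omega)
          have q3 := hmd n (by omega)
          rw [← le_div_iff₀ (by positivity)] at q3
          gcongr
      _ = (∑ n ∈ Finset.Ico (2^ν) (2 * 2^ν), ‖cc a b n - cc a b (n+1)‖) * (2^k * τ^k) +
            ((1+C) * A) * (k * (2^k * τ^k)) := by
          rw [Finset.sum_add_distrib, Finset.sum_mul, Finset.sum_const, Nat.card_Ico,
            show 2 * 2^ν - 2^ν = 2^ν by omega, nsmul_eq_mul]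
          push_cast
          congr 1
          field_simp
      _ ≤ ((1 + C) * A) * (2^k * τ^k) + ((1+C) * A) * (k * (2^k * τ^k)) := by
          have := cc_var ha hb hga hgb ν
          gcongr
          refine this.trans ?_
          gcongr
          linarith
      _ = _ := by ring

end



lemma fourier_unique {F : ℝ → ℂ} (hF : Integrable F torusMeasure)
    (h0 : ∀ n : ℤ, ∫ x, F x * ee (n * x) ∂torusMeasure = 0) :
    ∀ᵐ x ∂torusMeasure, F x = 0 := by
  have : Fact (0 < 2 * π) := ⟨by positivity⟩
  have hcomp : ∀ u : C(AddCircle (2*π), ℂ), Continuous fun x : ℝ => u (x : AddCircle (2*π)) :=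
    fun u => u.continuous.comp (AddCircle.continuous_mk' _)
  have hIntg : ∀ u : C(AddCircle (2*π), ℂ),
      Integrable (fun x : ℝ => F x * u (x : AddCircle (2*π))) torusMeasure := by
    intro u
    refine hF.mul_bdd (c := ‖u‖) (hcomp u).aestronglyMeasurable ?_
    exact Eventually.of_forall fun x => u.norm_coe_le_norm _
  let Λ0 : C(AddCircle (2*π), ℂ) →ₗ[ℂ] ℂ :=
    { toFun := fun u => ∫ x : ℝ, F x * u (x : AddCircle (2*π)) ∂torusMeasure
      map_add' := by
        intro u v
        rw [← integral_add (hIntg u) (hIntg v)]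
        congr 1; funext x; simp; ring
      map_smul' := by
        intro c u
        simp only [RingHom.id_apply, smul_eq_mul]
        rw [← integral_const_mul]
        congr 1; funext x; simp; ring }
  let Λ : C(AddCircle (2*π), ℂ) →L[ℂ] ℂ := Λ0.mkContinuous (∫ x, ‖F x‖ ∂torusMeasure) (by
    intro u
    show ‖∫ x : ℝ, F x * u (x : AddCircle (2*π)) ∂torusMeasure‖ ≤ _
    rw [← integral_mul_const]
    refine norm_integral_le_of_norm_le (hF.norm.mul_const _) (Eventually.of_forall fun x => ?_)
    rw [norm_mul]
    exact mul_le_mul_of_nonneg_left (u.norm_coe_le_norm _) (norm_nonneg _))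
  have hΛ : ∀ u, Λ u = ∫ x : ℝ, F x * u (x : AddCircle (2*π)) ∂torusMeasure := fun u => rfl
  have hker : ∀ u, Λ u = 0 := by
    have h1 : (Submodule.span ℂ (Set.range (fourier (T := 2*π)))) ≤ LinearMap.ker (Λ : C(AddCircle (2*π), ℂ) →ₗ[ℂ] ℂ) := by
      rw [Submodule.span_le]
      rintro _ ⟨n, rfl⟩
      show Λ (fourier n) = 0
      rw [hΛ, ← h0 n]
      congr 1
      funext x
      rw [fourier_coe_apply]
      unfold ee
      congr 2
      push_cast
      have : (π:ℂ) ≠ 0 := by exact_mod_cast Real.pi_ne_zero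
      field_simp
    have h2 := Submodule.topologicalClosure_minimal _ h1 (ContinuousLinearMap.isClosed_ker Λ)
    rw [span_fourier_closure_eq_top] at h2
    intro u
    exact h2 (Submodule.mem_top : u ∈ ⊤)
  have hae := IsOpen.ae_eq_zero_of_integral_contDiff_smul_eq_zero (μ := (volume : Measure ℝ)) (f := F)
    (U := Ioo 0 (2*π)) isOpen_Ioo
    (IntegrableOn.locallyIntegrableOn (show IntegrableOn F (Ioo 0 (2*π)) volume from hF)) (by
      intro g hg _ hsupp
      have hg0 : ∀ x, x ∉ Ioo 0 (2*π) → g x = 0 := fun x hx =>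
        image_eq_zero_of_notMem_tsupport fun h => hx (hsupp h)
      let G : ℝ → ℂ := fun x => (g x : ℂ)
      have hGc : Continuous (AddCircle.liftIco (2*π) 0 G) := by
        apply AddCircle.liftIco_zero_continuous
        · simp only [G]; rw [hg0 0 (by simp), hg0 (2*π) (by simp)]
        · exact (Complex.continuous_ofReal.comp hg.continuous).continuousOn
      have h1 := hker ⟨_, hGc⟩
      rw [hΛ] at h1
      rw [← h1]
      rw [← setIntegral_eq_integral_of_forall_compl_eq_zero (s := Ioo 0 (2*π))
        (fun x hx => by rw [hg0 x hx, zero_smul])]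
      unfold torusMeasure
      refine setIntegral_congr_fun measurableSet_Ioo fun x hx => ?_
      simp only [ContinuousMap.coe_mk]
      rw [AddCircle.liftIco_coe_apply (by simpa using ⟨hx.1.le, hx.2⟩)]
      simp only [G]
      rw [Complex.real_smul, mul_comm])
  unfold torusMeasure
  rw [ae_restrict_iff' measurableSet_Ioo]
  exact hae

lemma integral_ee (n : ℤ) : ∫ x, ee (n * x) ∂torusMeasure = if n = 0 then 2 * (π:ℂ) else 0 := by
  rw [← torus_interval]
  split_ifs with h
  · simp [h, ee_zero]
  · have hc : (n : ℂ) * Complex.I ≠ 0 := by simp [h]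
    have := integral_exp_mul_complex (a := 0) (b := 2 * π) hc
    have e : ∀ x : ℝ, ee (n * x) = Complex.exp ((n : ℂ) * Complex.I * x) := by
      intro x; unfold ee; congr 1; push_cast; ring
    simp_rw [e]
    rw [this]
    have h1 : Complex.exp ((n : ℂ) * Complex.I * ((2*π : ℝ):ℂ)) = 1 := by
      rw [← e]; exact ee_int_period n
    rw [h1]; simp

lemma Pblk_continuous (a b : ℕ → ℝ) (ν : ℕ) : Continuous (Pblk a b ν) := by
  unfold Pblk
  have := ee_continuous
  fun_prop

lemma ee_int_continuous (n : ℤ) : Continuous fun x : ℝ => ee (n * x) :=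
  ee_continuous.comp (by fun_prop)

instance torus_finite : IsFiniteMeasure torusMeasure := by
  unfold torusMeasure; infer_instance

lemma torus_cont_integrable {φ : ℝ → ℂ} (h : Continuous φ) : Integrable φ torusMeasure := by
  have : IntegrableOn φ (Icc 0 (2*π)) volume := h.integrableOn_Icc
  exact this.mono_set Ioo_subset_Icc_self

lemma Pblk_pair (a b : ℕ → ℝ) (ν : ℕ) (n : ℕ) :
    ∫ x, ((Pblk a b ν x).re : ℂ) * ee (((-(n:ℤ) : ℤ) : ℝ) * x) ∂torusMeasure =
      if n ∈ Finset.Ico (2^ν) (2 * 2^ν) then π * cc a b n else 0 := by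
  have e : ∀ x : ℝ, ((Pblk a b ν x).re : ℂ) * ee (((-(n:ℤ) : ℤ) : ℝ) * x) =
      ∑ m ∈ Finset.Ico (2^ν) (2 * 2^ν), ((cc a b m / 2) * ee ((((m:ℤ) - n : ℤ):ℝ) * x) +
        ((starRingEnd ℂ) (cc a b m) / 2) * ee (((-(m:ℤ) - n : ℤ):ℝ) * x)) := by
    intro x
    rw [Complex.re_eq_add_conj]
    unfold Pblk
    rw [map_sum, ← Finset.sum_add_distrib, Finset.sum_div, Finset.sum_mul]
    refine Finset.sum_congr rfl fun m _ => ?_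
    rw [map_mul, map_pow, ee_conj, ← ee_nat_mul, ← ee_nat_mul]
    have h1 : ee ((((m:ℤ) - n : ℤ):ℝ) * x) = ee (m * x) * ee (((-(n:ℤ) : ℤ) : ℝ) * x) := by
      rw [← ee_add]; congr 1; push_cast; ring
    have h2 : ee (((-(m:ℤ) - n : ℤ):ℝ) * x) = ee (m * -x) * ee (((-(n:ℤ) : ℤ) : ℝ) * x) := by
      rw [← ee_add]; congr 1; push_cast; ring
    rw [h1, h2]; ring
  simp_rw [e]
  have i1 : ∀ (c : ℂ) (z : ℤ), Integrable (fun x : ℝ => c * ee ((z:ℝ) * x)) torusMeasure := fun c z =>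
    torus_cont_integrable (continuous_const.mul (ee_int_continuous z))
  rw [integral_finsetSum]
  swap
  · exact fun m _ => (i1 _ _).add (i1 _ _)
  have h3 : ∀ m ∈ Finset.Ico (2^ν) (2 * 2^ν), ∫ x : ℝ, ((cc a b m / 2) * ee ((((m:ℤ) - n : ℤ):ℝ) * x) +
        ((starRingEnd ℂ) (cc a b m) / 2) * ee (((-(m:ℤ) - n : ℤ):ℝ) * x)) ∂torusMeasure =
        if m = n then π * cc a b n else 0 := by
    intro m hm
    rw [Finset.mem_Ico] at hm
    have hm1 : 1 ≤ m := Nat.one_le_two_pow.trans hm.1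
    rw [integral_add (i1 _ _) (i1 _ _), integral_const_mul, integral_const_mul, integral_ee, integral_ee,
      if_neg (show ¬ (-(m:ℤ) - n = 0) by omega)]
    by_cases h : m = n
    · subst h; simp; ring
    · rw [if_neg h, if_neg (by omega)]; simp
  rw [Finset.sum_congr rfl h3, Finset.sum_ite_eq']



lemma Wt_measurable (ν : ℕ) : Measurable (Wt ν) := by
  unfold Wt
  exact measurable_const.min (ENNReal.measurable_ofReal.comp rho_continuous.measurable).inv

lemma lint_Wt (ν : ℕ) : ∫⁻ x, Wt ν x ∂torusMeasure ≤ ENNReal.ofReal (2 * π) * (1 + ν) := by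
  have hE : ∀ m : ℕ, MeasurableSet {x | rho x < (1/2:ℝ)^m} := fun m =>
    measurableSet_lt rho_continuous.measurable measurable_const
  calc ∫⁻ x, Wt ν x ∂torusMeasure ≤ ∫⁻ x, (1 + ∑ m ∈ Finset.range ν,
        {x | rho x < (1/2:ℝ)^m}.indicator (fun _ => (2:ℝ≥0∞) ^ m) x) ∂torusMeasure :=
        lintegral_mono (Wt_layer ν)
    _ = torusMeasure univ + ∑ m ∈ Finset.range ν, 2 ^ m * torusMeasure {x | rho x < (1/2:ℝ)^m} := by
        rw [lintegral_add_left measurable_const, lintegral_one, lintegral_finsetSum _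
          (fun m _ => measurable_const.indicator (hE m))]
        congr 1
        refine Finset.sum_congr rfl fun m _ => ?_
        rw [lintegral_indicator_const (hE m)]
    _ ≤ ENNReal.ofReal (2*π) + ∑ m ∈ Finset.range ν, ENNReal.ofReal (2 * π) := by
        rw [torus_univ]
        gcongr with m hm
        have h1 := rho_meas 0 ((1/2:ℝ)^m)
        simp only [add_zero] at h1
        refine (mul_le_mul_right h1 _).trans (le_of_eq ?_)
        have e : (2:ℝ≥0∞)^m = ENNReal.ofReal (2^m) := by
          rw [ENNReal.ofReal_pow (by norm_num)]; simp
        rw [e, ← ENNReal.ofReal_mul (by positivity)]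
        congr 1
        rw [one_div, inv_pow]
        field_simp
    _ = _ := by simp; ring

lemma block_tsum (c : ℂ) (m : ℕ) (hm : 1 ≤ m) :
    ∑' ν : ℕ, (if m ∈ Finset.Ico (2^ν) (2 * 2^ν) then c else 0) = c := by
  rw [tsum_eq_single (Nat.log 2 m)]
  · rw [if_pos]
    rw [Finset.mem_Ico]
    refine ⟨Nat.pow_log_le_self 2 (by omega), ?_⟩
    have := Nat.lt_pow_succ_log_self (b := 2) (by norm_num) m
    rw [Nat.succ_eq_add_one, pow_succ'] at this
    exact this
  · intro ν hν
    rw [if_neg]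
    rw [Finset.mem_Ico]
    intro h
    apply hν
    symm
    apply Nat.log_eq_of_pow_le_of_lt_pow h.1
    rw [pow_succ']; exact h.2

lemma blocks_hasSum {C : ℝ} {a b : ℕ → ℝ} (hC : 0 < C) (ha : ∀ n, 0 ≤ a n) (hb : ∀ n, 0 ≤ b n)
    (hga : GMSeq C a) (hgb : GMSeq C b) {f : ℝ → ℝ}
    (hi : Integrable f torusMeasure)
    (hF : ∀ n : ℕ, 1 ≤ n → Four f n = π * ((a n : ℂ) - Complex.I * b n))
    (hF0 : Four f 0 = 0)
    (hs : ∑' ν : ℕ, ENNReal.ofReal (a (2^ν) + b (2^ν)) * (1 + ν) ≠ ∞) :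
    ∀ᵐ x ∂torusMeasure, HasSum (fun ν => (Pblk a b ν x).re) (f x) := by
  have hmeas : ∀ ν, Measurable (fun x => ‖Pblk a b ν x‖ₑ) := fun ν =>
    (Pblk_continuous a b ν).measurable.enorm
  have hT : ∑' ν, ∫⁻ x, ‖Pblk a b ν x‖ₑ ∂torusMeasure ≠ ∞ := by
    have hle : ∑' ν, ∫⁻ x, ‖Pblk a b ν x‖ₑ ∂torusMeasure ≤
        (ENNReal.ofReal (2 * (1 + C)) * ENNReal.ofReal (2 * π)) *
          ∑' ν : ℕ, ENNReal.ofReal (a (2^ν) + b (2^ν)) * (1 + ν) := by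
      rw [← ENNReal.tsum_mul_left]
      refine ENNReal.tsum_le_tsum fun ν => ?_
      calc ∫⁻ x, ‖Pblk a b ν x‖ₑ ∂torusMeasure ≤
          ∫⁻ x, ENNReal.ofReal (2 * ((1 + C) * (a (2^ν) + b (2^ν)))) * Wt ν x ∂torusMeasure :=
            lintegral_mono fun x => Pblk_bound hC ha hb hga hgb ν x
        _ = ENNReal.ofReal (2 * ((1 + C) * (a (2^ν) + b (2^ν)))) * ∫⁻ x, Wt ν x ∂torusMeasure := by
            rw [lintegral_const_mul _ (Wt_measurable ν)]
        _ ≤ ENNReal.ofReal (2 * ((1 + C) * (a (2^ν) + b (2^ν)))) * (ENNReal.ofReal (2 * π) * (1 + ν)) := by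
            gcongr; exact lint_Wt ν
        _ = _ := by
            rw [← mul_assoc 2, ENNReal.ofReal_mul (by positivity)]; ring
    exact ne_top_of_le_ne_top (ENNReal.mul_ne_top (by finiteness) hs) hle
  have hT2 : ∫⁻ x, ∑' ν, ‖Pblk a b ν x‖ₑ ∂torusMeasure ≠ ∞ := by
    rwa [lintegral_tsum (fun ν => (hmeas ν).aemeasurable)]
  have hreE : ∀ ν x, ‖((Pblk a b ν x).re : ℂ)‖ₑ ≤ ‖Pblk a b ν x‖ₑ := by
    intro ν x
    rw [← ofReal_norm, ← ofReal_norm]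
    apply ENNReal.ofReal_le_ofReal
    rw [Complex.norm_real]
    exact Complex.abs_re_le_norm _
  have hfin : ∀ᵐ x ∂torusMeasure, ∑' ν, ‖Pblk a b ν x‖ₑ < ∞ :=
    ae_lt_top (Measurable.ennreal_tsum hmeas) hT2
  have hsum : ∀ᵐ x ∂torusMeasure, Summable (fun ν => (Pblk a b ν x).re) := by
    filter_upwards [hfin] with x hx
    have h1 : Summable (fun ν => ‖Pblk a b ν x‖) := by
      have := ENNReal.summable_toReal hx.ne
      simpa using this
    have h2 : Summable (fun ν => Pblk a b ν x) := h1.of_norm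
    exact (Complex.hasSum_re h2.hasSum).summable
  have hrec : ∀ ν, Continuous (fun x => ((Pblk a b ν x).re)) := fun ν =>
    Complex.continuous_re.comp (Pblk_continuous a b ν)
  set G : ℝ → ℝ := fun x => ∑' ν, (Pblk a b ν x).re with hG
  have hGm : AEStronglyMeasurable G torusMeasure := by
    refine aestronglyMeasurable_of_tendsto_ae (u := atTop)
      (f := fun n x => ∑ ν ∈ Finset.range n, (Pblk a b ν x).re) ?_ ?_
    · intro n
      exact (continuous_finsetSum _ fun ν _ => hrec ν).aestronglyMeasurable
    · filter_upwards [hsum] with x hx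
      exact hx.hasSum.tendsto_sum_nat
  have hGc : ∀ x, ((G x : ℝ) : ℂ) = ∑' ν, ((Pblk a b ν x).re : ℂ) := fun x => by
    rw [hG]; exact Complex.ofReal_tsum _
  have hGi : Integrable (fun x => (G x : ℂ)) torusMeasure := by
    refine ⟨(Complex.continuous_ofReal.comp_aestronglyMeasurable hGm), ?_⟩
    refine lt_of_le_of_lt (lintegral_mono fun x => ?_) (lt_top_iff_ne_top.2 hT2)
    show ‖((G x : ℝ) : ℂ)‖ₑ ≤ _
    rw [hGc]
    exact enorm_tsum_le_tsum_enorm.trans (ENNReal.tsum_le_tsum fun ν => hreE ν x)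
  have hbd : ∀ (φ : ℝ → ℂ), Integrable φ torusMeasure → ∀ n : ℤ,
      Integrable (fun x => φ x * ee (n * x)) torusMeasure := fun φ hφ n =>
    hφ.mul_bdd (c := 1) (ee_int_continuous n).aestronglyMeasurable
      (Eventually.of_forall fun x => (ee_norm _).le)
  have hfi : Integrable (fun x => (f x : ℂ)) torusMeasure := hi.ofReal
  have hneg : ∀ m : ℕ, ∫ x, ((f x - G x : ℝ) : ℂ) * ee (((-(m:ℤ) : ℤ):ℝ) * x) ∂torusMeasure = 0 := by
    intro m
    have e1 : ∫ x, ((f x - G x : ℝ) : ℂ) * ee (((-(m:ℤ) : ℤ):ℝ) * x) ∂torusMeasure =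
        ∫ x, (f x : ℂ) * ee (((-(m:ℤ) : ℤ):ℝ) * x) ∂torusMeasure -
        ∫ x, (G x : ℂ) * ee (((-(m:ℤ) : ℤ):ℝ) * x) ∂torusMeasure := by
      rw [← integral_sub (hbd _ hfi _) (hbd _ hGi _)]
      congr 1; funext x; push_cast; ring
    have e2 : ∫ x, (f x : ℂ) * ee (((-(m:ℤ) : ℤ):ℝ) * x) ∂torusMeasure = Four f m := by
      unfold Four
      rw [torus_interval]
      congr 1; funext x; congr 2; push_cast; ring
    have e3 : ∫ x, (G x : ℂ) * ee (((-(m:ℤ) : ℤ):ℝ) * x) ∂torusMeasure =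
        ∑' ν : ℕ, (if m ∈ Finset.Ico (2^ν) (2 * 2^ν) then π * cc a b m else 0) := by
      simp_rw [hGc, ← tsum_mul_right]
      rw [integral_tsum]
      · congr 1; funext ν; exact Pblk_pair a b ν m
      · intro ν
        exact ((Complex.continuous_ofReal.comp (hrec ν)).mul (ee_int_continuous _)).aestronglyMeasurable
      · refine ne_top_of_le_ne_top hT (ENNReal.tsum_le_tsum fun ν => lintegral_mono fun x => ?_)
        rw [enorm_mul]
        have : ‖ee (((-(m:ℤ) : ℤ):ℝ) * x)‖ₑ = 1 := by rw [← ofReal_norm, ee_norm]; simp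
        rw [this, mul_one]
        exact hreE ν x
    rw [e1, e2, e3]
    rcases Nat.eq_zero_or_pos m with h | h
    · subst h
      have : ∀ ν : ℕ, (if 0 ∈ Finset.Ico (2^ν) (2 * 2^ν) then (π:ℂ) * cc a b 0 else 0) = 0 := by
        intro ν
        rw [if_neg]
        rw [Finset.mem_Ico]
        intro h
        have : 1 ≤ 2 ^ ν := Nat.one_le_two_pow
        omega
      simp_rw [this, tsum_zero, sub_zero]
      exact_mod_cast hF0
    · rw [block_tsum _ _ h, hF m h]; simp [cc]
  have hall : ∀ n : ℤ, ∫ x, ((f x - G x : ℝ) : ℂ) * ee (n * x) ∂torusMeasure = 0 := by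
    intro n
    rcases le_total n 0 with h | h
    · have := hneg n.natAbs
      have e : (-(n.natAbs:ℤ)) = n := by omega
      rwa [e] at this
    · have := hneg n.natAbs
      have e : ((n.natAbs:ℤ)) = n := by omega
      rw [e] at this
      have h2 := congrArg (starRingEnd ℂ) this
      rw [← integral_conj, map_zero] at h2
      rw [← h2]
      congr 1; funext x
      rw [map_mul, Complex.conj_ofReal, ee_conj]
      congr 2; push_cast; ring
  have hz := fourier_unique (F := fun x => ((f x - G x : ℝ) : ℂ)) (by
    have := hfi.sub hGi
    refine this.congr (Eventually.of_forall fun x => ?_)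
    simp) hall
  filter_upwards [hz, hsum] with x hx hsx
  have : f x = G x := by
    have : f x - G x = 0 := by exact_mod_cast hx
    linarith
  rw [this]
  exact hsx.hasSum



lemma ae_periodic {Q : ℝ → Prop} (hper : ∀ x, Q (x + 2 * π) ↔ Q x)
    (h : ∀ᵐ x ∂torusMeasure, Q x) (s : ℝ) : ∀ᵐ x ∂torusMeasure, Q (x + s) := by
  have h2pi : 0 < 2 * π := by positivity
  set N : Set ℝ := {x | ¬ Q x} with hN
  have hIntg : ∀ (n : ℤ) x, Q (x + n * (2 * π)) ↔ Q x := by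
    intro n
    induction n using Int.induction_on with
    | zero => intro x; simp
    | succ i ih =>
      intro x
      rw [← ih x, ← hper (x + ((i : ℤ) : ℝ) * (2 * π))]
      apply iff_of_eq; congr 1; push_cast; ring
    | pred i ih =>
      intro x
      rw [← ih x, ← hper]
      apply iff_of_eq; congr 1; push_cast; ring
  have hN0 : volume N = 0 := by
    refine (isAddFundamentalDomain_Ioc h2pi 0 volume).measure_zero_of_invariant N ?_ ?_
    · rintro ⟨g, hg⟩
      obtain ⟨n, rfl⟩ := AddSubgroup.mem_zmultiples_iff.1 hg
      ext x
      rw [Set.mem_vadd_set_iff_neg_vadd_mem]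
      have := hIntg (-n) x
      simp only [hN, mem_setOf_eq]
      rw [← this]
      apply not_congr
      apply iff_of_eq; congr 1
      show -(n • (2*π)) + x = _
      simp; ring
    · unfold torusMeasure at h
      rw [restrict_Ioo_eq_restrict_Ioc, ae_iff] at h
      rw [Measure.restrict_apply₀'] at h
      · simpa using h
      · exact measurableSet_Ioc.nullMeasurableSet
  have h1 : ∀ᵐ x ∂(volume : Measure ℝ), Q x := hN0
  have h2 : ∀ᵐ x ∂(volume : Measure ℝ), Q (x + s) :=
    (measurePreserving_add_right volume s).quasiMeasurePreserving.ae h1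
  exact ae_restrict_of_ae h2

lemma iter_formula (k : ℕ) (h : ℝ) (f : ℝ → ℝ) (x : ℝ) : iterDiffT k h f x =
    ∑ l ∈ Finset.range (k+1), ((-1:ℝ)^(k-l) * (k.choose l : ℝ)) * f (x + l * h) := by
  have := fwdDiff_iter_eq_sum_shift h f k x
  have e : iterDiffT k h f x = (fwdDiff h)^[k] f x := rfl
  rw [e, this]
  refine Finset.sum_congr rfl fun l _ => ?_
  rw [zsmul_eq_mul, nsmul_eq_mul]
  push_cast
  rfl

/-- constant in the block estimate -/
def upC (k : ℕ) (C : ℝ) : ℝ := 2 * ((1 + C) * (k+1) * 2 ^ k)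

section
variable {C : ℝ} {a b : ℕ → ℝ}

lemma block_diff (hC : 0 < C) (ha : ∀ n, 0 ≤ a n) (hb : ∀ n, 0 ≤ b n)
    (hga : GMSeq C a) (hgb : GMSeq C b) (k j ν : ℕ) (h : ℝ) (hh : |h| ≤ (1/2:ℝ)^j) (x : ℝ) :
    ‖∑ l ∈ Finset.range (k+1), ((-1:ℝ)^(k-l) * (k.choose l : ℝ)) * (Pblk a b ν (x + l * h)).re‖ₑ ≤
      ENNReal.ofReal (upC k C * ((a (2^ν) + b (2^ν)) * tauF k j ν)) *
        ∑ l ∈ Finset.range (k+1), Wt ν (x + l * h) := by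
  have hA0 : 0 ≤ a (2^ν) + b (2^ν) := add_nonneg (ha _) (hb _)
  have hre : ∑ l ∈ Finset.range (k+1), ((-1:ℝ)^(k-l) * (k.choose l : ℝ)) * (Pblk a b ν (x + l * h)).re =
      (∑ l ∈ Finset.range (k+1), (((-1:ℝ)^(k-l) * (k.choose l : ℝ) : ℝ) : ℂ) * Pblk a b ν (x + l * h)).re := by
    rw [Complex.re_sum]
    refine Finset.sum_congr rfl fun l _ => ?_
    rw [Complex.re_ofReal_mul]
  rw [hre]
  have hle : ∀ z : ℂ, ‖z.re‖ₑ ≤ ‖z‖ₑ := fun z => by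
    rw [← ofReal_norm, ← ofReal_norm]
    exact ENNReal.ofReal_le_ofReal (Complex.abs_re_le_norm z)
  refine (hle _).trans ?_
  rcases le_total ν j with hν | hν
  · have e : ∑ l ∈ Finset.range (k+1), (((-1:ℝ)^(k-l) * (k.choose l : ℝ) : ℝ) : ℂ) * Pblk a b ν (x + l * h) =
        ∑ n ∈ Finset.Ico (2^ν) (2 * 2^ν), (cc a b n * (ee h ^ n - 1) ^ k) * ee x ^ n := by
      unfold Pblk
      simp_rw [Finset.mul_sum]
      rw [Finset.sum_comm]
      refine Finset.sum_congr rfl fun n _ => ?_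
      rw [sub_eq_add_neg (ee h ^ n), add_pow, Finset.mul_sum, Finset.sum_mul]
      refine Finset.sum_congr rfl fun l _ => ?_
      have : ee (x + l * h) = ee x * ee h ^ l := by rw [ee_add, ee_nat_mul]
      rw [this, mul_pow, ← pow_mul, ← pow_mul, mul_comm l n]
      push_cast
      ring
    rw [e]
    refine (mult_bound hC ha hb hga hgb k j ν hν h hh x).trans ?_
    refine mul_le_mul' (le_of_eq ?_) ?_
    · congr 1; unfold upC; ring
    · have := Finset.single_le_sum (f := fun l : ℕ => Wt ν (x + l * h)) (s := Finset.range (k+1))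
        (fun _ _ => zero_le) (Finset.mem_range.2 (Nat.succ_pos k))
      simpa using this
  · rw [tauF_high hν, mul_one, Finset.mul_sum]
    refine (enorm_sum_le _ _).trans (Finset.sum_le_sum fun l hl => ?_)
    rw [enorm_mul]
    have h1 : ‖(((-1:ℝ)^(k-l) * (k.choose l : ℝ) : ℝ) : ℂ)‖ₑ ≤ ENNReal.ofReal (2^k) := by
      rw [← ofReal_norm, Complex.norm_real, norm_mul, norm_pow, norm_neg, norm_one, one_pow, one_mul]
      apply ENNReal.ofReal_le_ofReal
      rw [Real.norm_natCast]
      have : k.choose l ≤ 2 ^ k := Nat.choose_le_two_pow _ _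
      exact_mod_cast this
    refine (mul_le_mul' h1 (Pblk_bound hC ha hb hga hgb ν _)).trans ?_
    rw [← mul_assoc, ← ENNReal.ofReal_mul (by positivity)]
    refine mul_le_mul_left (ENNReal.ofReal_le_ofReal ?_) _
    unfold upC
    have hk : (1:ℝ) ≤ k + 1 := by linarith [Nat.cast_nonneg (α := ℝ) k]
    calc (2:ℝ)^k * (2 * ((1 + C) * (a (2^ν) + b (2^ν)))) =
        (2 * ((1+C) * 2^k)) * (a (2^ν) + b (2^ν)) * 1 := by ring
      _ ≤ (2 * ((1+C) * 2^k)) * (a (2^ν) + b (2^ν)) * (k+1) := by gcongr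
      _ = _ := by ring

lemma Pblk_periodic (ν : ℕ) (x : ℝ) : Pblk a b ν (x + 2 * π) = Pblk a b ν x := by
  have : ee (x + 2 * π) = ee x := by
    rw [ee_add]
    have := ee_int_period 1
    simp only [Int.cast_one, one_mul] at this
    rw [this, mul_one]
  unfold Pblk
  rw [this]

lemma diff_pointwise (hC : 0 < C) (ha : ∀ n, 0 ≤ a n) (hb : ∀ n, 0 ≤ b n)
    (hga : GMSeq C a) (hgb : GMSeq C b) {f : ℝ → ℝ} (hf : Function.Periodic f (2 * π))
    (hS : ∀ᵐ x ∂torusMeasure, HasSum (fun ν => (Pblk a b ν x).re) (f x))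
    (k j : ℕ) (h : ℝ) (hh : |h| ≤ (1/2:ℝ)^j) :
    ∀ᵐ x ∂torusMeasure, ENNReal.ofReal |iterDiffT k h f x| ≤
      ∑' ν, ENNReal.ofReal (upC k C * ((a (2^ν) + b (2^ν)) * tauF k j ν)) *
        ∑ l ∈ Finset.range (k+1), Wt ν (x + l * h) := by
  have hall : ∀ᵐ x ∂torusMeasure, ∀ l : ℕ, HasSum (fun ν => (Pblk a b ν (x + l * h)).re) (f (x + l * h)) := by
    rw [ae_all_iff]
    intro l
    refine ae_periodic (Q := fun x => HasSum (fun ν => (Pblk a b ν x).re) (f x)) ?_ hS _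
    intro x
    simp only [Pblk_periodic, hf x]
  filter_upwards [hall] with x hx
  have h1 : HasSum (fun ν => ∑ l ∈ Finset.range (k+1), ((-1:ℝ)^(k-l) * (k.choose l : ℝ)) *
      (Pblk a b ν (x + l * h)).re) (iterDiffT k h f x) := by
    rw [iter_formula]
    exact hasSum_sum fun l _ => (hx l).mul_left _
  rw [← h1.tsum_eq, ← Real.norm_eq_abs, ofReal_norm]
  exact enorm_tsum_le_tsum_enorm.trans
    (ENNReal.tsum_le_tsum fun ν => block_diff hC ha hb hga hgb k j ν h hh x)

lemma rearr_bound (hC : 0 < C) (ha : ∀ n, 0 ≤ a n) (hb : ∀ n, 0 ≤ b n)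
    (hga : GMSeq C a) (hgb : GMSeq C b) {f : ℝ → ℝ} (hf : Function.Periodic f (2 * π))
    (hS : ∀ᵐ x ∂torusMeasure, HasSum (fun ν => (Pblk a b ν x).re) (f x))
    (k j : ℕ) (h : ℝ) (hh : |h| ≤ (1/2:ℝ)^j) (m : ℕ) :
    rearrR torusMeasure (iterDiffT k h f) ((1/2:ℝ)^m) ≤
      ∑' ν, ENNReal.ofReal (upC k C * ((a (2^ν) + b (2^ν)) * tauF k j ν)) *
        ((k+1) * (ENNReal.ofReal (2 * π * (k+1)) * 2 ^ (min ν m))) := by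
  apply rearrR_le
  set w : ℝ := 2 * π * (k+1) with hw
  have hp3 := Real.pi_gt_three
  have hw1 : 1 ≤ w := by
    rw [hw]
    have : (0:ℝ) ≤ k := Nat.cast_nonneg k
    nlinarith
  have hw0 : 0 < w := by linarith
  set r : ℝ := (1/2:ℝ)^m / w with hr
  set E : Set ℝ := ⋃ l ∈ Finset.range (k+1), {x | rho (x + (l:ℕ) * h) < r} with hE
  have hEm : torusMeasure E ≤ ENNReal.ofReal ((1/2:ℝ)^m) := by
    calc torusMeasure E ≤ ∑ l ∈ Finset.range (k+1), torusMeasure {x | rho (x + (l:ℕ) * h) < r} :=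
          measure_biUnion_finset_le _ _
      _ ≤ ∑ l ∈ Finset.range (k+1), ENNReal.ofReal (2 * π * r) :=
          Finset.sum_le_sum fun l _ => rho_meas _ _
      _ = ENNReal.ofReal ((k+1 : ℕ) * (2 * π * r)) := by
          rw [Finset.sum_const, Finset.card_range, nsmul_eq_mul,
            ENNReal.ofReal_mul (p := ((k+1 : ℕ) : ℝ)) (by positivity), ENNReal.ofReal_natCast]
      _ = _ := by
          congr 1
          rw [hr, hw]; push_cast; field_simp
  refine le_trans ?_ hEm
  apply measure_mono_ae
  filter_upwards [diff_pointwise hC ha hb hga hgb hf hS k j h hh] with x hx hlt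
  by_contra hxE
  replace hxE : ¬ x ∈ E := hxE
  have hgood : ∀ l ∈ Finset.range (k+1), r ≤ rho (x + (l:ℕ) * h) := by
    intro l hl
    by_contra hc
    apply hxE
    rw [hE]
    exact mem_biUnion (Finset.mem_coe.2 hl) (by simpa using hc)
  refine absurd hlt (not_lt.2 (hx.trans (ENNReal.tsum_le_tsum fun ν => ?_)))
  refine mul_le_mul_right ?_ _
  calc ∑ l ∈ Finset.range (k+1), Wt ν (x + l * h) ≤
      ∑ l ∈ Finset.range (k+1), ENNReal.ofReal w * 2 ^ (min ν m) := by
        refine Finset.sum_le_sum fun l hl => ?_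
        have hr0 : 0 < r := by positivity
        have h1 : Wt ν (x + l * h) ≤ ENNReal.ofReal w * 2 ^ m := by
          refine (min_le_right _ _).trans ?_
          calc (ENNReal.ofReal (rho (x + l * h)))⁻¹ ≤ (ENNReal.ofReal r)⁻¹ :=
                ENNReal.inv_le_inv.2 (ENNReal.ofReal_le_ofReal (hgood l hl))
            _ = ENNReal.ofReal (w * 2^m) := by
                rw [← ENNReal.ofReal_inv_of_pos hr0]; congr 1
                rw [hr, one_div, inv_pow]; field_simp
            _ = _ := by
                rw [ENNReal.ofReal_mul hw0.le, ENNReal.ofReal_pow (by norm_num)]; simp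
        have h2 : Wt ν (x + l * h) ≤ ENNReal.ofReal w * 2 ^ ν := by
          refine (Wt_le _ _).trans ?_
          refine le_mul_of_one_le_left zero_le ?_
          rw [← ENNReal.ofReal_one]
          exact ENNReal.ofReal_le_ofReal hw1
        rcases min_cases ν m with hc | hc
        · rw [hc.1]; exact h2
        · rw [hc.1]; exact h1
    _ = _ := by rw [Finset.sum_const, Finset.card_range, nsmul_eq_mul]; push_cast; ring

lemma upper_kernel {p : ℝ} (hp : 1 < p) (m ν : ℕ) :
    ENNReal.ofReal ((2:ℝ) ^ (-(m:ℝ) / p)) * 2 ^ (min ν m) ≤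
      gker (thetaP p) m ν * ENNReal.ofReal ((2:ℝ) ^ ((ν:ℝ) * (1 - 1/p))) := by
  have h1 : 0 < 1/p := by positivity
  have h2 : 1/p < 1 := by rw [div_lt_one (by linarith)]; exact hp
  rw [gker_theta]
  have e4 : (2:ℝ≥0∞) ^ (min ν m) = ENNReal.ofReal ((2:ℝ) ^ ((min ν m : ℕ) : ℝ)) := by
    rw [Real.rpow_natCast, ENNReal.ofReal_pow (by norm_num)]; simp
  rw [e4, ← ENNReal.ofReal_mul (by positivity), ← ENNReal.ofReal_mul (by positivity),
    ← Real.rpow_add two_pos, ← Real.rpow_add two_pos]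
  apply ENNReal.ofReal_le_ofReal
  apply Real.rpow_le_rpow_of_exponent_le (by norm_num)
  have d1 := min_le_left (1/p) (1 - 1/p)
  have d2 := min_le_right (1/p) (1 - 1/p)
  set δ := min (1/p) (1 - 1/p)
  have e : -(m:ℝ)/p = -(m * (1/p)) := by ring
  rw [e]
  rcases le_total ν m with h | h
  · have hc : (ν:ℝ) ≤ m := by exact_mod_cast h
    rw [min_eq_left h, abs_of_nonneg (by linarith)]
    nlinarith
  · have hc : (m:ℝ) ≤ ν := by exact_mod_cast h
    rw [min_eq_right h, abs_of_nonpos (by linarith)]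
    nlinarith

lemma Xseq_bound (hC : 0 < C) (ha : ∀ n, 0 ≤ a n) (hb : ∀ n, 0 ≤ b n)
    (hga : GMSeq C a) (hgb : GMSeq C b) {f : ℝ → ℝ} (hf : Function.Periodic f (2 * π))
    (hS : ∀ᵐ x ∂torusMeasure, HasSum (fun ν => (Pblk a b ν x).re) (f x))
    {p : ℝ} (hp : 1 < p) (k j : ℕ) (h : ℝ) (hh : |h| ≤ (1/2:ℝ)^j) (m : ℕ) :
    Xseq p (iterDiffT k h f) m ≤ ∑' ν, gker (thetaP p) m ν *
      ((ENNReal.ofReal (upC k C) * ((k+1) * ENNReal.ofReal (2 * π * (k+1)))) * yseq k j (1 - 1/p) a b ν) := by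
  unfold Xseq
  refine (mul_le_mul_right (rearr_bound hC ha hb hga hgb hf hS k j h hh m) _).trans ?_
  rw [← ENNReal.tsum_mul_left]
  refine ENNReal.tsum_le_tsum fun ν => ?_
  have hu : 0 ≤ upC k C := by unfold upC; positivity
  have hτ := tauF_nonneg k j ν
  have hA0 : 0 ≤ a (2^ν) + b (2^ν) := add_nonneg (ha _) (hb _)
  rw [ENNReal.ofReal_mul hu]
  unfold yseq
  rw [mul_assoc ((2:ℝ) ^ _), ENNReal.ofReal_mul (p := (2:ℝ) ^ _) (by positivity)]
  set T := ENNReal.ofReal ((a (2^ν) + b (2^ν)) * tauF k j ν)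
  calc _ = (ENNReal.ofReal ((2:ℝ) ^ (-(m:ℝ) / p)) * 2 ^ (min ν m)) *
        ((ENNReal.ofReal (upC k C) * ((k+1) * ENNReal.ofReal (2 * π * (k+1)))) * T) := by ring
    _ ≤ (gker (thetaP p) m ν * ENNReal.ofReal ((2:ℝ) ^ ((ν:ℝ) * (1 - 1/p)))) *
        ((ENNReal.ofReal (upC k C) * ((k+1) * ENNReal.ofReal (2 * π * (k+1)))) * T) := by
        gcongr ?_ * _
        exact upper_kernel hp m ν
    _ = _ := by ring

lemma summ_of_fin {p : ℝ} (hp : 1 < p) {q : ℝ≥0∞} (hq : 0 < q)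
    (ha : ∀ n, 0 ≤ a n) (hb : ∀ n, 0 ≤ b n) (k j : ℕ)
    (hfin : ellq q (yseq k j (1 - 1/p) a b) ≠ ∞) :
    ∑' ν : ℕ, ENNReal.ofReal (a (2^ν) + b (2^ν)) * (1 + ν) ≠ ∞ := by
  have h2 : 1/p < 1 := by rw [div_lt_one (by linarith)]; exact hp
  set e := 1 - 1/p with he
  have he0 : 0 < e := by linarith
  set K := ellq q (yseq k j e a b) with hK
  set t0 : ℝ := ((1/2:ℝ)^j)^k with ht0
  have ht : 0 < t0 := by positivity
  set r : ℝ := (2:ℝ) ^ (-e) with hr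
  have hr0 : 0 < r := by positivity
  have hr1 : r < 1 := Real.rpow_lt_one_of_one_lt_of_neg (by norm_num) (by linarith)
  have hterm : ∀ ν : ℕ, ENNReal.ofReal (a (2^ν) + b (2^ν)) * (1 + ν) ≤
      (K * ENNReal.ofReal t0⁻¹) * ENNReal.ofReal ((1 + ν) * r ^ ν) := by
    intro ν
    have hA0 : 0 ≤ a (2^ν) + b (2^ν) := add_nonneg (ha _) (hb _)
    have hy := ellq_le_term hq (yseq k j e a b) ν
    rw [← hK] at hy
    have htau : t0 ≤ tauF k j ν := by
      rw [ht0]; unfold tauF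
      apply pow_le_pow_left₀ (by positivity)
      apply le_min
      · exact pow_le_one₀ (by norm_num) (by norm_num)
      · rw [one_div, inv_pow, ← one_div]
        gcongr
        exact one_le_pow₀ (by norm_num)
    have h1 : ENNReal.ofReal ((2:ℝ) ^ ((ν:ℝ) * e) * (a (2 ^ ν) + b (2 ^ ν)) * t0) ≤ K := by
      refine le_trans (ENNReal.ofReal_le_ofReal ?_) hy
      gcongr
    have hrr : (2:ℝ) ^ ((ν:ℝ) * e) * r ^ ν = 1 := by
      rw [hr, ← Real.rpow_natCast, ← Real.rpow_mul (by norm_num), ← Real.rpow_add two_pos]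
      rw [show (ν:ℝ)*e + -e*ν = 0 by ring, Real.rpow_zero]
    calc ENNReal.ofReal (a (2^ν) + b (2^ν)) * (1 + ν)
        = ENNReal.ofReal ((2:ℝ) ^ ((ν:ℝ) * e) * (a (2 ^ ν) + b (2 ^ ν)) * t0) *
          ENNReal.ofReal t0⁻¹ * ENNReal.ofReal ((1 + ν) * r ^ ν) := by
          have e1 : (1 + ν : ℝ≥0∞) = ENNReal.ofReal (1 + ν) := by
            rw [ENNReal.ofReal_add (by norm_num) (by positivity)]; simp
          rw [e1, ← ENNReal.ofReal_mul hA0, ← ENNReal.ofReal_mul (by positivity),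
            ← ENNReal.ofReal_mul (by positivity)]
          congr 1
          calc _ = (a (2^ν) + b (2^ν)) * (1 + ν) * ((2:ℝ) ^ ((ν:ℝ) * e) * r ^ ν) * (t0 * t0⁻¹) := by
                rw [hrr, mul_inv_cancel₀ ht.ne']; ring
            _ = _ := by ring
      _ ≤ _ := by gcongr
  refine ne_top_of_le_ne_top ?_ (ENNReal.tsum_le_tsum hterm)
  rw [ENNReal.tsum_mul_left]
  refine ENNReal.mul_ne_top (by finiteness) ?_
  have hsum : Summable (fun ν : ℕ => (1 + (ν:ℝ)) * r ^ ν) := by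
    have s1 := summable_geometric_of_lt_one hr0.le hr1
    have s2 := summable_pow_mul_geometric_of_norm_lt_one 1 (r := r) (by rwa [Real.norm_eq_abs, abs_of_pos hr0])
    refine (s1.add s2).congr fun ν => ?_
    simp; ring
  rw [← ENNReal.ofReal_tsum_of_nonneg (fun ν => by positivity) hsum]
  exact ENNReal.ofReal_ne_top

end

/-- the upper half of the theorem -/
lemma upper_final {p : ℝ} (hp : 1 < p) {q : ℝ≥0∞} (hq : 0 < q) (k : ℕ) {C : ℝ} (hC : 0 < C) :
    ∃ D : ℝ≥0∞, D ≠ ∞ ∧ ∀ (f : ℝ → ℝ) (a b : ℕ → ℝ),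
      Function.Periodic f (2 * π) → Integrable f torusMeasure →
      (∀ n, 0 ≤ a n) → (∀ n, 0 ≤ b n) → GMSeq C a → GMSeq C b →
      (∀ n : ℕ, 1 ≤ n → Four f n = π * ((a n : ℂ) - Complex.I * b n)) → Four f 0 = 0 → ∀ j : ℕ,
      modulusT k f p q ((2:ℝ) ^ (-(j:ℝ))) ≤ D * rhsT q k j (1 - 1/p) a b := by
  obtain ⟨C1, hC1, H1⟩ := le_rhsT hq
  obtain ⟨C2, hC2, H2⟩ := ellq_young hq (thetaP p) (thetaP_lt hp)
  set K : ℝ≥0∞ := ENNReal.ofReal (upC k C) * ((k+1) * ENNReal.ofReal (2 * π * (k+1))) with hK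
  have hKf : K ≠ ∞ := by rw [hK]; finiteness
  refine ⟨ENNReal.ofReal ((2:ℝ)^(1/p)) * (C2 * (K * C1)) + 1, by finiteness, ?_⟩
  intro f a b hf hi ha hb hga hgb hF hF0 j
  by_cases hfin : ellq q (yseq k j (1 - 1/p) a b) = ∞
  · have h1 := H1 k j (1-1/p) a b ha hb
    rw [hfin] at h1
    have h2 : rhsT q k j (1-1/p) a b = ∞ := by
      by_contra hne
      exact (ENNReal.mul_ne_top hC1 hne) (top_le_iff.1 h1)
    rw [h2, ENNReal.mul_top (by simp)]
    exact le_top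
  · have hS := blocks_hasSum hC ha hb hga hgb hi hF hF0 (summ_of_fin hp hq ha hb k j hfin)
    unfold modulusT
    refine iSup₂_le fun h hh => ?_
    have hh' : |h| ≤ (1/2:ℝ)^j := by
      have hh1 : |h| ≤ (2:ℝ) ^ (-(j:ℝ)) := hh
      rwa [Real.rpow_neg (by norm_num), Real.rpow_natCast, ← inv_pow, ← one_div] at hh1
    have hX := H2 _ _ (Xseq_bound hC ha hb hga hgb hf hS hp k j h hh')
    rw [ellq_const_mul hq] at hX
    calc lorentzT (iterDiffT k h f) p q ≤ ENNReal.ofReal ((2:ℝ)^(1/p)) * ellq q (Xseq p (iterDiffT k h f)) :=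
          lorentz_le hp hq _
      _ ≤ ENNReal.ofReal ((2:ℝ)^(1/p)) * (C2 * (K * (C1 * rhsT q k j (1-1/p) a b))) := by
          refine mul_le_mul_right (hX.trans ?_) _
          refine mul_le_mul_right (mul_le_mul_right (H1 k j (1-1/p) a b ha hb) _) _
      _ = (ENNReal.ofReal ((2:ℝ)^(1/p)) * (C2 * (K * C1))) * rhsT q k j (1-1/p) a b := by ring
      _ ≤ _ := by gcongr; exact le_self_add


/-- Two-sided estimate of the Lorentz modulus of smoothness of Fourier series
with general monotone coefficients (Lemma 4.4). -/
theorem statement18 (p : ℝ) (hp : 1 < p) (q : ℝ≥0∞) (hq : 0 < q)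
    (k : ℕ) (hk0 : 0 < k) (Cgm : ℝ) (hCgm : 0 < Cgm) :
    ∃ c₁ c₂ : ℝ, 0 < c₁ ∧ 0 < c₂ ∧
      ∀ (f : ℝ → ℝ) (a b : ℕ → ℝ), Measurable f → Function.Periodic f (2 * π) →
        IntegrableOn f (Set.Ioo 0 (2 * π)) volume →
        (∀ n, 0 ≤ a n) → (∀ n, 0 ≤ b n) → GMSeq Cgm a → GMSeq Cgm b →
        (∀ n : ℕ, 1 ≤ n →
          (∫ x in Set.Ioo 0 (2 * π), f x * Real.cos (n * x)) = π * a n ∧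
          (∫ x in Set.Ioo 0 (2 * π), f x * Real.sin (n * x)) = π * b n) →
        (∫ x in Set.Ioo 0 (2 * π), f x) = 0 →
        ∀ j : ℕ,
          ENNReal.ofReal c₁ *
              (ENNReal.ofReal ((2 : ℝ) ^ (-(j : ℝ) * k)) *
                  dyadS1 q ((k : ℝ) + 1 / (p / (p - 1))) a b j +
                dyadS2 q (1 / (p / (p - 1))) a b j) ≤
            modulusT k f p q ((2 : ℝ) ^ (-(j : ℝ))) ∧
          modulusT k f p q ((2 : ℝ) ^ (-(j : ℝ))) ≤
            ENNReal.ofReal c₂ *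
              (ENNReal.ofReal ((2 : ℝ) ^ (-(j : ℝ) * k)) *
                  dyadS1 q ((k : ℝ) + 1 / (p / (p - 1))) a b j +
                dyadS2 q (1 / (p / (p - 1))) a b j) := by
  obtain ⟨D₁, hD₁, H₁⟩ := lower_final hp hq k hCgm
  obtain ⟨D₂, hD₂, H₂⟩ := upper_final hp hq k hCgm
  have hD₁0 : (0:ℝ) < D₁.toReal + 1 := by positivity
  have hD₂0 : (0:ℝ) < D₂.toReal + 1 := by positivity
  have hpp : 1 / (p / (p - 1)) = 1 - 1 / p := by
    have h1 : p ≠ 0 := by linarith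
    have h2 : p - 1 ≠ 0 := by linarith
    field_simp
  have hle₁ : D₁ ≤ ENNReal.ofReal (D₁.toReal + 1) := by
    conv_lhs => rw [← ENNReal.ofReal_toReal hD₁]
    exact ENNReal.ofReal_le_ofReal (by linarith)
  have hle₂ : D₂ ≤ ENNReal.ofReal (D₂.toReal + 1) := by
    conv_lhs => rw [← ENNReal.ofReal_toReal hD₂]
    exact ENNReal.ofReal_le_ofReal (by linarith)
  refine ⟨(D₁.toReal + 1)⁻¹, D₂.toReal + 1, by positivity, hD₂0, ?_⟩
  intro f a b hm hf hi ha hb hga hgb hF hF0 j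
  have h2pi : (0:ℝ) ≤ 2 * π := by positivity
  have hi' : IntervalIntegrable f volume 0 (2 * π) :=
    (intervalIntegrable_iff_integrableOn_Ioo_of_le h2pi).2 hi
  have hFour : ∀ n : ℕ, 1 ≤ n → Four f n = π * ((a n : ℂ) - Complex.I * b n) :=
    fun n hn => four_coef hi' n (hF n hn).1 (hF n hn).2
  have hFour0 : Four f 0 = 0 := by
    have e : ∀ x : ℝ, (f x : ℂ) * ee (-(((0 : ℤ) : ℝ) * x)) = ((f x : ℝ) : ℂ) := by
      intro x; simp [ee_zero]
    unfold Four
    simp_rw [e]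
    rw [intervalIntegral.integral_ofReal, torus_interval]
    unfold torusMeasure
    rw [hF0]; simp
  rw [hpp]
  have L := H₁ f a b hm hf hi' ha hb hga hgb hFour j
  have U := H₂ f a b hf hi ha hb hga hgb hFour hFour0 j
  unfold rhsT at L U
  constructor
  · rw [ENNReal.ofReal_inv_of_pos hD₁0, ENNReal.inv_mul_le_iff (by simpa using hD₁0) (by simp)]
    exact L.trans (by gcongr)
  · exact U.trans (by gcongr)

end
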